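/- Let K be a field of characteristic zero, let V and W be finite-dimensional K-vector spaces with dim V = d₁ and dim W = d₂, and let the group Γ = GL(V) × GL(W) act on U = End(V ⊗ W) by (g,h)·φ = (g⊗h)∘φ∘(g⊗h)⁻¹. Then for every n ≥ 0, the dimension of the n-th homogeneous component of the invariant ring K[U]^Γ equals the sum of g(λ,μ,ν)² over all partitions λ of n with at most d₁ parts, all partitions μ of n with at most d₂ parts, and all partitions ν of n, where g(λ,μ,ν) are the Kronecker coefficients of Sₙ. -/

import Mathlib

open CategoryTheory MonoidalCategory

open PowerSeries

/-- The space of `Γ`-invariant homogeneous polynomial functions of degree `n` on `U`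
(for the action `act` of `Γ` on `U`): functions `U → K` which are restrictions to the
diagonal of an `n`-multilinear form (over a field of characteristic zero this is exactly
the degree-`n` homogeneous polynomial functions) and which are invariant under `act`.
This is the `n`-th homogeneous component `(K[U]^Γ)ₙ` of the invariant ring. -/
def invariantPolynomials (K : Type) [Field K] {U Γ : Type} [AddCommGroup U] [Module K U]
    (act : Γ → U → U) (n : ℕ) : Submodule K (U → K) where
  carrier := {F | (∃ m : MultilinearMap K (fun _ : Fin n => U) K, ∀ u, F u = m fun _ => u) ∧
    ∀ γ u, F (act γ u) = F u}
  add_mem' := by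
    rintro F G ⟨⟨mF, hF⟩, hFi⟩ ⟨⟨mG, hG⟩, hGi⟩
    refine ⟨⟨mF + mG, fun u => ?_⟩, fun γ u => ?_⟩
    · simp [hF, hG]
    · simp [Pi.add_apply, hFi γ u, hGi γ u]
  zero_mem' := by
    refine ⟨⟨0, fun u => ?_⟩, fun γ u => rfl⟩
    simp
  smul_mem' := by
    rintro c F ⟨⟨mF, hF⟩, hFi⟩
    refine ⟨⟨c • mF, fun u => ?_⟩, fun γ u => ?_⟩
    · simp [hF]
    · simp [Pi.smul_apply, hFi γ u]

/-- The action of `Γ = GL(V) × GL(W)` on `U = End(V ⊗ W)` given by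
`(g,h) · φ = (g⊗h) ∘ φ ∘ (g⊗h)⁻¹`. -/
noncomputable def tensorConjAction (K : Type) [Field K] (V W : Type) [AddCommGroup V]
    [Module K V] [AddCommGroup W] [Module K W] :
    ((V ≃ₗ[K] V) × (W ≃ₗ[K] W)) →
      (TensorProduct K V W →ₗ[K] TensorProduct K V W) →
      (TensorProduct K V W →ₗ[K] TensorProduct K V W) :=
  fun γ φ => (TensorProduct.congr γ.1 γ.2).toLinearMap ∘ₗ φ ∘ₗ
    (TensorProduct.congr γ.1 γ.2).symm.toLinearMap

/-- `listBlock L t` is the index of the block containing `t` when `{0,1,2,…}` is divided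
into consecutive blocks of sizes `L = [l₁, l₂, …]`: it is the number of partial sums
`l₁, l₁+l₂, …` that are `≤ t`. -/
def listBlock (L : List ℕ) (t : ℕ) : ℕ :=
  (L.scanl (· + ·) 0).tail.countP fun s => decide (s ≤ t)

/-- `listCol L t` is the position of `t` within its block (the column index of the cell `t`
in the canonical filling of the Young diagram with row lengths `L`). -/
def listCol (L : List ℕ) (t : ℕ) : ℕ :=
  t - ((L.scanl (· + ·) 0).filter fun s => decide (s ≤ t)).foldr max 0

/-- The parts of a partition, listed in weakly decreasing order. -/
def partsList {m : ℕ} (mu : Nat.Partition m) : List ℕ := (mu.parts.sort (· ≤ ·)).reverse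

/-- The subgroup of permutations of `Fin N` preserving the fibers of `f` pointwise on values,
i.e. `{σ | f ∘ σ = f}`. -/
def stabSubgroup (N : ℕ) (f : Fin N → ℕ) : Subgroup (Equiv.Perm (Fin N)) where
  carrier := {σ | ∀ t, f (σ t) = f t}
  one_mem' := fun _ => rfl
  mul_mem' := by
    intro σ τ hσ hτ t
    have h1 : f (σ (τ t)) = f (τ t) := hσ (τ t)
    have h2 : f (τ t) = f t := hτ t
    simpa [Equiv.Perm.mul_apply, h2] using h1
  inv_mem' := by
    intro σ hσ t
    have h1 : f (σ (σ⁻¹ t)) = f (σ⁻¹ t) := hσ (σ⁻¹ t)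
    simpa using h1.symm

instance stabDecidable' (N : ℕ) (f : Fin N → ℕ) : DecidablePred (· ∈ stabSubgroup N f) :=
  fun σ => decidable_of_iff (∀ t, f (σ t) = f t) Iff.rfl

/-- The row function of the canonical tableau of the partition `mu` of `m`, placed on the
block `[o, o+m)` of `{0, …, N−1}`; points outside the block get their own distinct values
(so that the stabilizer of this function consists of the permutations fixing the complement
of the block pointwise and preserving the rows of the tableau). -/
def shiftedRowFn (N o m : ℕ) (mu : Nat.Partition m) : Fin N → ℕ := fun t =>
  if o ≤ t.val ∧ t.val < o + m then N + listBlock (partsList mu) (t.val - o) else t.val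

/-- Column analogue of `shiftedRowFn`. -/
def shiftedColFn (N o m : ℕ) (mu : Nat.Partition m) : Fin N → ℕ := fun t =>
  if o ≤ t.val ∧ t.val < o + m then N + listCol (partsList mu) (t.val - o) else t.val

/-- The Young symmetrizer of the partition `mu` of `m`, for the canonical tableau placed on
the block `[o, o+m)` of `{0, …, N−1}`, as an element of the group algebra `K[S_N]`:
`(Σ_{p ∈ row group} p) · (Σ_{q ∈ column group} sgn(q) q)`. -/
noncomputable def blockYoungSymmetrizer (K : Type) [Field K] (N o m : ℕ)
    (mu : Nat.Partition m) : MonoidAlgebra K (Equiv.Perm (Fin N)) :=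
  (∑ p : stabSubgroup N (shiftedRowFn N o m mu),
      MonoidAlgebra.single (p : Equiv.Perm (Fin N)) (1 : K)) *
  (∑ q : stabSubgroup N (shiftedColFn N o m mu),
      MonoidAlgebra.single (q : Equiv.Perm (Fin N))
        ((Equiv.Perm.sign (q : Equiv.Perm (Fin N)) : ℤ) : K))

/-- The Specht module of the partition `lam` of `n`, realized as the left ideal
`K[Sₙ]·e_lam` of the group algebra generated by the Young symmetrizer of `lam`,
i.e. as a module over the group algebra `K[Sₙ]` (equivalently, a representation of `Sₙ`). -/
noncomputable def spechtIdeal (K : Type) [Field K] (n : ℕ) (lam : Nat.Partition n) :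
    Submodule (MonoidAlgebra K (Equiv.Perm (Fin n))) (MonoidAlgebra K (Equiv.Perm (Fin n))) :=
  Submodule.span _ {blockYoungSymmetrizer K n 0 n lam}

/-- The Specht module of `lam ⊢ n` as an object of the category `Rep K Sₙ` of
representations of the symmetric group, via the equivalence of `Rep K Sₙ` with the category
of modules over the group algebra. -/
noncomputable def specht (K : Type) [Field K] (n : ℕ) (lam : Nat.Partition n) :
    Rep K (Equiv.Perm (Fin n)) :=
  Rep.equivalenceModuleMonoidAlgebra.inverse.obj
    (ModuleCat.of (MonoidAlgebra K (Equiv.Perm (Fin n))) (spechtIdeal K n lam))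

/-- The Kronecker coefficient `g(λ,μ,ν)`: the multiplicity of the Specht module `S_ν` in
`S_λ ⊗ S_μ` (diagonal `Sₙ`-action), computed (over a field of characteristic zero, where
the Specht modules are absolutely irreducible) as `dim Hom_{Sₙ}(S_ν, S_λ ⊗ S_μ)`. -/
noncomputable def kron (K : Type) [Field K] {n : ℕ} (lam mu nu : Nat.Partition n) : ℕ :=
  Module.finrank K (specht K n nu ⟶ specht K n lam ⊗ specht K n mu)

namespace KroneckerInvariants

open Representation

section GroupAlgebra

variable {K G : Type*} [Field K] [Group G] [Fintype G]

theorem groupAlgebra_eq_sum (x : MonoidAlgebra K G) :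
    x = ∑ g : G, x.coeff g • MonoidAlgebra.of K G g := by
  classical
  ext h
  simp [MonoidAlgebra.coeff_sum]

/-- The basis of the group algebra given by the group elements. -/
noncomputable def groupBasis (K G : Type*) [Field K] [Group G] :
    Module.Basis G K (MonoidAlgebra K G) :=
  ⟨MonoidAlgebra.coeffLinearEquiv K⟩

theorem trace_mulLeft (x : MonoidAlgebra K G) :
    LinearMap.trace K _ (LinearMap.mulLeft K x) = Fintype.card G * x.coeff 1 := by
  classical
  rw [LinearMap.trace_eq_matrix_trace K (groupBasis K G), Matrix.trace]
  have h : ∀ g : G, (LinearMap.toMatrix (groupBasis K G) (groupBasis K G)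
      (LinearMap.mulLeft K x)).diag g = x.coeff 1 := by
    intro g
    have : groupBasis K G g = MonoidAlgebra.single g 1 := rfl
    rw [Matrix.diag_apply, LinearMap.toMatrix_apply, this, LinearMap.mulLeft_apply]
    change (x * MonoidAlgebra.single g 1).coeff g = _
    simp
  rw [Finset.sum_congr rfl fun g _ => h g]
  simp

variable [CharZero K]

theorem coeff_one_eq_zero_of_isNilpotent {x : MonoidAlgebra K G} (hx : IsNilpotent x) :
    x.coeff 1 = 0 := by
  have h1 : IsNilpotent (LinearMap.mulLeft K x) := by
    obtain ⟨m, hm⟩ := hx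
    exact ⟨m, by rw [LinearMap.pow_mulLeft, hm]; ext; simp⟩
  have h2 := LinearMap.isNilpotent_trace_of_isNilpotent h1
  rw [trace_mulLeft] at h2
  simpa using h2

theorem eq_zero_of_forall_mul_mul_eq_zero {z : MonoidAlgebra K G} (h : ∀ y, z * y * z = 0) :
    z = 0 := by
  ext g
  have : IsNilpotent (z * MonoidAlgebra.single g⁻¹ 1) :=
    ⟨2, by rw [pow_two, ← mul_assoc, h, zero_mul]⟩
  simpa using coeff_one_eq_zero_of_isNilpotent this

end GroupAlgebra

section Characters

variable {K G ι : Type*} [Field K] [CharZero K] [Group G] [Fintype G] [Fintype ι] [DecidableEq ι]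
  {S : ι → Type*} [∀ i, AddCommGroup (S i)] [∀ i, Module K (S i)]
  [∀ i, FiniteDimensional K (S i)] (ρ : ∀ i, Representation K G (S i))

theorem sum_char_mul_char_inv {V W : Type*} [AddCommGroup V] [Module K V] [FiniteDimensional K V]
    [AddCommGroup W] [Module K W] [FiniteDimensional K W] (ρ : Representation K G V)
    (σ : Representation K G W) :
    ∑ g : G, σ.character g * ρ.character g⁻¹ =
      Nat.card G * Module.finrank K (IntertwiningMap ρ σ) := by
  have h0 : (Nat.card G : K) ≠ 0 := by simp
  let _ := invertibleOfNonzero h0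
  rw [← card_inv_mul_sum_char_mul_char_eq_finrank]
  field_simp

variable (horth : ∀ i j, Module.finrank K (IntertwiningMap (ρ i) (ρ j)) = if i = j then 1 else 0)
  (hcard : Nat.card (ConjClasses G) ≤ Fintype.card ι)
include horth hcard

theorem exists_eq_sum_character (f : G → K) (hf : ∀ g h, f (h * g * h⁻¹) = f g) :
    ∃ a : ι → K, ∀ g, f g = ∑ i, a i * (ρ i).character g := by
  classical
  have lift : ∀ f : G → K, (∀ g h, f (h * g * h⁻¹) = f g) →
      ∃ F : ConjClasses G → K, ∀ g, F (ConjClasses.mk g) = f g := by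
    intro f hf
    refine ⟨Quotient.lift f ?_, fun g => rfl⟩
    intro a b hab
    obtain ⟨c, hc⟩ := isConj_iff.1 (show IsConj a b from hab)
    rw [← hc, hf]
  choose χ hχ using fun i => lift (ρ i).character (fun g h => char_conj (ρ i) g h)
  have hli : LinearIndependent K χ := by
    rw [Fintype.linearIndependent_iff]
    intro a ha j
    have h1 : ∀ g, ∑ i, a i * (ρ i).character g = 0 := by
      intro g
      have := congrFun ha (ConjClasses.mk g)
      simpa [hχ] using this
    have h2 : ∑ g : G, (∑ i, a i * (ρ i).character g) * (ρ j).character g⁻¹ = 0 := by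
      simp [h1]
    simp_rw [Finset.sum_mul, mul_assoc] at h2
    rw [Finset.sum_comm] at h2
    simp_rw [← Finset.mul_sum, sum_char_mul_char_inv, horth] at h2
    simpa using h2
  have hspan := hli.span_eq_top_of_card_eq_finrank' (by
    have := hli.fintype_card_le_finrank
    rw [Module.finrank_fintype_fun_eq_card] at *
    rw [Nat.card_eq_fintype_card] at hcard
    omega)
  obtain ⟨F, hF⟩ := lift f hf
  have hFm : F ∈ Submodule.span K (Set.range χ) := hspan ▸ Submodule.mem_top
  obtain ⟨a, ha⟩ := (Submodule.mem_span_range_iff_exists_fun K).1 hFm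
  refine ⟨a, fun g => ?_⟩
  have := congrFun ha (ConjClasses.mk g)
  rw [← hF, ← this]
  simp [hχ]

theorem character_eq_sum {M : Type*} [AddCommGroup M] [Module K M] [FiniteDimensional K M]
    (τ : Representation K G M) (g : G) :
    τ.character g = ∑ i, (Module.finrank K (IntertwiningMap (ρ i) τ) : K) *
      (ρ i).character g := by
  obtain ⟨a, ha⟩ := exists_eq_sum_character ρ horth hcard τ.character
    (fun g h => char_conj τ g h)
  rw [ha]
  refine Finset.sum_congr rfl fun j _ => ?_
  congr 1
  have h1 := sum_char_mul_char_inv (ρ j) τ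
  simp_rw [ha, Finset.sum_mul, mul_assoc] at h1
  rw [Finset.sum_comm] at h1
  simp_rw [← Finset.mul_sum, sum_char_mul_char_inv, horth] at h1
  have h0 : (Nat.card G : K) ≠ 0 := by simp
  simp only [Nat.cast_ite, Nat.cast_one, Nat.cast_zero, mul_ite, mul_one, mul_zero,
    Finset.sum_ite_eq, Finset.mem_univ, if_true] at h1
  apply mul_left_cancel₀ h0
  rw [← h1, mul_comm]

theorem finrank_intertwiningMap_self {M : Type*} [AddCommGroup M] [Module K M]
    [FiniteDimensional K M] (τ : Representation K G M) :
    Module.finrank K (IntertwiningMap τ τ) =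
      ∑ i, Module.finrank K (IntertwiningMap (ρ i) τ) ^ 2 := by
  have h1 := sum_char_mul_char_inv τ τ
  simp_rw [character_eq_sum ρ horth hcard τ (_⁻¹), Finset.mul_sum] at h1
  rw [Finset.sum_comm] at h1
  simp_rw [mul_left_comm, ← Finset.mul_sum, sum_char_mul_char_inv] at h1
  have h0 : (Nat.card G : K) ≠ 0 := by simp
  simp_rw [mul_left_comm _ (Nat.card G : K), ← Finset.mul_sum] at h1
  have h2 := mul_left_cancel₀ h0 h1
  rw [← Nat.cast_inj (R := K), ← h2]
  simp [pow_two]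

theorem sum_finrank_mul_character (g : G) [DecidableEq G] :
    ∑ i, (Module.finrank K (S i) : K) * (ρ i).character g =
      if g = 1 then (Fintype.card G : K) else 0 := by
  obtain ⟨a, ha⟩ := exists_eq_sum_character ρ horth hcard (fun g => if g = 1 then 1 else 0)
    (fun g h => by simp)
  have haj : ∀ j, (Module.finrank K (S j) : K) = Nat.card G * a j := by
    intro j
    have h1 : ∑ g : G, (if g = 1 then (1 : K) else 0) * (ρ j).character g⁻¹ =
        Module.finrank K (S j) := by simp
    rw [← h1]
    simp_rw [ha, Finset.sum_mul, mul_assoc]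
    rw [Finset.sum_comm]
    simp_rw [← Finset.mul_sum, sum_char_mul_char_inv, horth]
    simp [mul_comm]
  simp_rw [haj, mul_assoc, ← Finset.mul_sum, ← ha]
  simp

end Characters

end KroneckerInvariants

namespace KroneckerInvariants

open Representation

section Simple

variable {K V : Type*} [Field K] [AddCommGroup V] [Module K V] [FiniteDimensional K V]

theorem eq_top_of_ideal_ne_zero (J : Submodule K (Module.End K V))
    (hl : ∀ a, ∀ f ∈ J, a * f ∈ J) (hr : ∀ a, ∀ f ∈ J, f * a ∈ J)
    {f : Module.End K V} (hf : f ∈ J) (hf0 : f ≠ 0) : (1 : Module.End K V) ∈ J := by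
  obtain ⟨v, hv⟩ : ∃ v, f v ≠ 0 := by
    by_contra! h
    exact hf0 (LinearMap.ext h)
  obtain ⟨ψ, hψ⟩ := Module.Projective.exists_dual_ne_zero K hv
  let b := Module.finBasis K V
  have key : ∀ i, (b.coord i).smulRight (b i) ∈ J := by
    intro i
    have h1 := hl ((ψ (f v))⁻¹ • ψ.smulRight (b i)) _ (hr ((b.coord i).smulRight v) f hf)
    convert h1 using 1
    ext w
    simp [smul_smul]
    field_simp
  have : (1 : Module.End K V) = ∑ i, (b.coord i).smulRight (b i) := by
    ext w
    simp [LinearMap.sum_apply, b.sum_repr]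
  rw [this]
  exact Submodule.sum_mem _ fun i _ => key i

end Simple

section ProductOfEndomorphisms

variable {K G ι : Type*} [Field K] [CharZero K] [Group G] [Fintype G] [Fintype ι] [DecidableEq ι]
  {S : ι → Type*} [∀ i, AddCommGroup (S i)] [∀ i, Module K (S i)]
  [∀ i, FiniteDimensional K (S i)] (ρ : ∀ i, Representation K G (S i))

/-- The joint action of the group algebra on a family of representations. -/
noncomputable def toEndPi : MonoidAlgebra K G →ₐ[K] (∀ i, Module.End K (S i)) :=
  AlgHom.pi fun i => (ρ i).asAlgebraHom

variable [DecidableEq G] (hreg : ∀ g : G, ∑ i, (Module.finrank K (S i) : K) * (ρ i).character g =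
      if g = 1 then (Fintype.card G : K) else 0)
include hreg

omit [DecidableEq ι] in
theorem toEndPi_bijective : Function.Bijective (toEndPi ρ) := by
  have hinj : Function.Injective (toEndPi ρ) := by
    rw [injective_iff_map_eq_zero]
    intro x hx
    have htr : ∀ y : MonoidAlgebra K G, ∑ i, (Module.finrank K (S i) : K) *
        LinearMap.trace K _ ((ρ i).asAlgebraHom y) = Fintype.card G * y.coeff 1 := by
      intro y
      have hy : ∀ i, LinearMap.trace K _ ((ρ i).asAlgebraHom y) =
          ∑ g, y.coeff g * (ρ i).character g := by
        intro i
        conv_lhs => rw [groupAlgebra_eq_sum y]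
        simp only [map_sum, map_smul, asAlgebraHom_of, smul_eq_mul]
        rfl
      simp_rw [hy, Finset.mul_sum]
      rw [Finset.sum_comm]
      have hg : ∀ g, ∑ i, (Module.finrank K (S i) : K) * (y.coeff g * (ρ i).character g) =
          y.coeff g * if g = 1 then (Fintype.card G : K) else 0 := by
        intro g
        rw [← hreg, Finset.mul_sum]
        exact Finset.sum_congr rfl fun i _ => mul_left_comm _ _ _
      simp_rw [hg]
      simp [mul_comm]
    ext g
    have h1 := htr (x * MonoidAlgebra.single g⁻¹ 1)
    have h2 : ∀ i, (ρ i).asAlgebraHom x = 0 := fun i => congrFun hx i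
    simpa [map_mul, h2] using h1
  refine ⟨hinj, ?_⟩
  have hdim : Module.finrank K (MonoidAlgebra K G) =
      Module.finrank K (∀ i, Module.End K (S i)) := by
    rw [Module.finrank_eq_card_basis (groupBasis K G), Module.finrank_pi_fintype]
    have h1 := hreg 1
    simp only [char_one, if_true] at h1
    rw [← Nat.cast_inj (R := K), ← h1, Nat.cast_sum]
    refine Finset.sum_congr rfl fun i _ => ?_
    rw [← Nat.cast_mul]
    exact congrArg Nat.cast (Module.finrank_linearMap K K (S i) (S i)).symm
  have : FiniteDimensional K (MonoidAlgebra K G) := (groupBasis K G).finiteDimensional_of_finite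
  exact (LinearMap.injective_iff_surjective_of_finrank_eq_finrank
    (f := (toEndPi ρ).toLinearMap) hdim).1 hinj

variable {B : Type*} [Ring B] [Algebra K B] (Ψ : MonoidAlgebra K G →ₐ[K] B)
  (c : ι → MonoidAlgebra K G)
  (hc : ∀ i j, (ρ j).asAlgebraHom (c i) = 0 ↔ i ≠ j)
include hc

theorem algHom_eq_zero_iff (x : MonoidAlgebra K G) :
    Ψ x = 0 ↔ ∀ i, Ψ (c i) ≠ 0 → (ρ i).asAlgebraHom x = 0 := by
  have hbij := toEndPi_bijective ρ hreg
  let Θ := AlgEquiv.ofBijective (toEndPi ρ) hbij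
  have hΘ : ∀ y i, Θ y i = (ρ i).asAlgebraHom y := fun y i => rfl
  let J : ∀ i, Submodule K (Module.End K (S i)) := fun i =>
    LinearMap.ker (Ψ.toLinearMap ∘ₗ Θ.symm.toLinearMap ∘ₗ
      LinearMap.single K (fun i => Module.End K (S i)) i)
  have hJ : ∀ i f, f ∈ J i ↔ Ψ (Θ.symm (Pi.single i f)) = 0 := fun i f => Iff.rfl
  have hmul : ∀ i (a b : Module.End K (S i)), Ψ (Θ.symm (Pi.single i (a * b))) =
      Ψ (Θ.symm (Pi.single i a)) * Ψ (Θ.symm (Pi.single i b)) := by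
    intro i a b
    rw [← map_mul, ← map_mul, ← Pi.single_mul]
  have hone : ∀ i f, f ∈ J i → f ≠ 0 → (1 : Module.End K (S i)) ∈ J i := by
    intro i f hf hf0
    refine eq_top_of_ideal_ne_zero (J i) ?_ ?_ hf hf0
    · intro a g hg
      rw [hJ] at hg ⊢
      rw [hmul, hg, mul_zero]
    · intro a g hg
      rw [hJ] at hg ⊢
      rw [hmul, hg, zero_mul]
  have hall : ∀ i f, (1 : Module.End K (S i)) ∈ J i → f ∈ J i := by
    intro i f hf
    rw [hJ] at hf ⊢
    rw [← one_mul f, hmul, hf, zero_mul]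
  have hci : ∀ i, c i = Θ.symm (Pi.single i ((ρ i).asAlgebraHom (c i))) := by
    intro i
    rw [AlgEquiv.eq_symm_apply]
    ext1 j
    rw [hΘ]
    by_cases hij : i = j
    · subst hij; simp
    · rw [(hc i j).2 hij, Pi.single_eq_of_ne (Ne.symm hij)]
  have hx : Ψ x = ∑ i, Ψ (Θ.symm (Pi.single i ((ρ i).asAlgebraHom x))) := by
    rw [← map_sum, ← map_sum]
    congr 1
    rw [AlgEquiv.eq_symm_apply]
    ext1 j
    rw [hΘ, Finset.sum_apply]
    simp [Finset.sum_pi_single]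
  constructor
  · intro h0 i hi
    by_contra hne
    have hmem : (ρ i).asAlgebraHom x ∈ J i := by
      rw [hJ]
      have : Pi.single i ((ρ i).asAlgebraHom x) = Θ x * Pi.single i 1 := by
        ext1 j
        by_cases hij : j = i
        · subst hij; simp [hΘ]
        · simp [Pi.single_eq_of_ne hij]
      rw [this, map_mul, AlgEquiv.symm_apply_apply, map_mul, h0, zero_mul]
    apply hi
    rw [hci, ← hJ]
    exact hall i _ (hone i _ hmem hne)
  · intro h
    rw [hx]
    refine Finset.sum_eq_zero fun i _ => ?_
    by_cases hi : Ψ (c i) = 0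
    · rw [← hJ]
      refine hall i _ (hone i ((ρ i).asAlgebraHom (c i)) ?_ ?_)
      · rw [hJ, ← hci, hi]
      · simp [hc]
    · rw [h i hi]
      simp

variable {Δ : Type*} [Monoid Δ] (δ : Δ →* G)

theorem finrank_range_commuting [DecidablePred fun i => Ψ (c i) ≠ 0] (C : Submodule K B)
    (hC : ∀ T, T ∈ C ↔ T ∈ Ψ.range ∧
      ∀ s, T * Ψ (MonoidAlgebra.of K G (δ s)) = Ψ (MonoidAlgebra.of K G (δ s)) * T) :
    Module.finrank K C = ∑ i, if Ψ (c i) ≠ 0 then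
      Module.finrank K (IntertwiningMap (MonoidHom.comp (ρ i) δ) (MonoidHom.comp (ρ i) δ))
        else 0 := by
  have hbij := toEndPi_bijective ρ hreg
  let Θ := AlgEquiv.ofBijective (toEndPi ρ) hbij
  have hΘ : ∀ y i, Θ y i = (ρ i).asAlgebraHom y := fun y i => rfl
  have hker : ∀ F, Ψ (Θ.symm F) = 0 ↔ ∀ i, Ψ (c i) ≠ 0 → F i = 0 := by
    intro F
    rw [algHom_eq_zero_iff ρ hreg Ψ c hc]
    simp_rw [← hΘ, AlgEquiv.apply_symm_apply]
  let E := fun i => IntertwiningMap (MonoidHom.comp (ρ i) δ) (MonoidHom.comp (ρ i) δ)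
  let ext0 : (∀ i : {i // Ψ (c i) ≠ 0}, E i) →ₗ[K] (∀ i, Module.End K (S i)) :=
    LinearMap.pi fun i => if h : Ψ (c i) ≠ 0 then
      (IntertwiningMap.toLinearMapl _ _).comp
        (LinearMap.proj (R := K) (φ := fun i : {i // Ψ (c i) ≠ 0} => E i) ⟨i, h⟩) else 0
  have hext : ∀ (f : ∀ i : {i // Ψ (c i) ≠ 0}, E i) i (h : Ψ (c i) ≠ 0),
      ext0 f i = (f ⟨i, h⟩).toLinearMap := by
    intro f i h
    simp only [ext0, LinearMap.pi_apply, dif_pos h]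
    rfl
  let L := Ψ.toLinearMap ∘ₗ Θ.symm.toLinearMap ∘ₗ ext0
  have hL : ∀ f, L f = Ψ (Θ.symm (ext0 f)) := fun f => rfl
  have hLinj : Function.Injective L := by
    rw [injective_iff_map_eq_zero]
    intro f hf
    rw [hL, hker] at hf
    ext1 ⟨i, hi⟩
    apply IntertwiningMap.ext
    rw [← hext, hf i hi]
    rfl
  have hcomm : ∀ F : (∀ i, Module.End K (S i)),
      (∀ s, Ψ (Θ.symm F) * Ψ (MonoidAlgebra.of K G (δ s)) =
        Ψ (MonoidAlgebra.of K G (δ s)) * Ψ (Θ.symm F)) ↔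
      ∀ i, Ψ (c i) ≠ 0 → ∀ s, F i * ρ i (δ s) = ρ i (δ s) * F i := by
    intro F
    have : ∀ s, Ψ (Θ.symm F) * Ψ (MonoidAlgebra.of K G (δ s)) =
        Ψ (MonoidAlgebra.of K G (δ s)) * Ψ (Θ.symm F) ↔
        ∀ i, Ψ (c i) ≠ 0 → F i * ρ i (δ s) = ρ i (δ s) * F i := by
      intro s
      rw [← sub_eq_zero, ← Θ.symm_apply_apply (MonoidAlgebra.of K G (δ s)), ← map_mul,
        ← map_mul, ← map_mul, ← map_mul, ← map_sub, ← map_sub, hker]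
      refine forall_congr' fun i => imp_congr_right fun _ => ?_
      rw [Pi.sub_apply, Pi.mul_apply, Pi.mul_apply, hΘ, asAlgebraHom_of, sub_eq_zero]
    simp_rw [this]
    exact ⟨fun h i hi s => h s i hi, fun h s i hi => h i hi s⟩
  have hrange : LinearMap.range L = C := by
    ext T
    rw [hC, LinearMap.mem_range]
    constructor
    · rintro ⟨f, rfl⟩
      refine ⟨⟨_, rfl⟩, ?_⟩
      rw [hL, hcomm]
      intro i hi s
      rw [hext _ _ hi]
      exact (f ⟨i, hi⟩).isIntertwining' s
    · rintro ⟨⟨x, rfl⟩, hT⟩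
      obtain ⟨F, rfl⟩ := Θ.symm.surjective x
      have hF := (hcomm F).1 hT
      refine ⟨fun i => ⟨F i, fun s => hF i i.2 s⟩, ?_⟩
      change _ = Ψ (Θ.symm F)
      rw [hL, ← sub_eq_zero, ← map_sub, ← map_sub, hker]
      intro i hi
      rw [Pi.sub_apply, hext _ _ hi, sub_self]
  rw [← hrange, LinearMap.finrank_range_of_inj hLinj, Module.finrank_pi_fintype,
    ← Finset.sum_filter, Finset.sum_subtype (p := fun i => Ψ (c i) ≠ 0)]
  simp

end ProductOfEndomorphisms

end KroneckerInvariants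

namespace KroneckerInvariants

section Combinatorics

theorem sum_range_add_card_le (A : Finset ℕ) :
    ∑ x ∈ Finset.range A.card, x + (Finset.range A.card \ A).card ≤ ∑ x ∈ A, x := by
  set R := Finset.range A.card with hR
  have h1 : ∑ x ∈ R \ A, (x + 1) ≤ (R \ A).card * A.card := by
    rw [← smul_eq_mul]
    refine Finset.sum_le_card_nsmul _ _ _ fun x hx => ?_
    have := (Finset.mem_sdiff.1 hx).1
    rw [hR, Finset.mem_range] at this
    omega
  have h2 : (A \ R).card * A.card ≤ ∑ x ∈ A \ R, x := by
    rw [← smul_eq_mul]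
    refine Finset.card_nsmul_le_sum _ _ _ fun x hx => ?_
    have := (Finset.mem_sdiff.1 hx).2
    rw [hR, Finset.mem_range] at this
    omega
  have h3 : (A \ R).card = (R \ A).card :=
    Finset.card_sdiff_comm (by rw [hR, Finset.card_range])
  have h4 := Finset.sum_inter_add_sum_sdiff A R fun x => x
  have h5 := Finset.sum_inter_add_sum_sdiff R A fun x => x
  rw [Finset.inter_comm] at h5
  rw [Finset.sum_add_distrib, Finset.sum_const, smul_eq_mul, mul_one] at h1
  rw [h3] at h2
  omega

/-- The pair of functions `(r, c)` puts the elements of `α` bijectively on the cells of a subset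
of `ℕ × ℕ` each of whose columns is an initial segment. -/
structure IsTableau {α : Type*} (r c : α → ℕ) : Prop where
  injective : Function.Injective fun t => (r t, c t)
  exists_above : ∀ t, ∀ k < r t, ∃ s, r s = k ∧ c s = c t

variable {α : Type*} [Fintype α] {r c : α → ℕ}

theorem IsTableau.image_column (h : IsTableau r c) (j : ℕ) :
    (Finset.univ.filter fun t => c t = j).image r =
      Finset.range (Finset.univ.filter fun t => c t = j).card := by
  set A := (Finset.univ.filter fun t => c t = j).image r with hA
  have hcard : A.card = (Finset.univ.filter fun t => c t = j).card := by
    refine Finset.card_image_of_injOn fun x hx y hy hxy => h.injective ?_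
    simp only [Finset.coe_filter, Finset.mem_univ, true_and, Set.mem_ofPred_eq] at hx hy
    exact Prod.ext hxy (hx.trans hy.symm)
  rw [← hcard]
  symm
  have hlower : ∀ m ∈ A, ∀ k < m, k ∈ A := by
    intro m hm k hk
    obtain ⟨t, ht, rfl⟩ := Finset.mem_image.1 hm
    obtain ⟨s, hs, hs'⟩ := h.exists_above t k hk
    refine Finset.mem_image.2 ⟨s, ?_, hs⟩
    simp only [Finset.mem_filter, Finset.mem_univ, true_and] at ht ⊢
    rw [hs', ht]
  refine (Finset.eq_of_subset_of_card_le (fun m hm => ?_) (by simp)).symm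
  rw [Finset.mem_range]
  have : Finset.range (m + 1) ⊆ A := by
    intro k hk
    rw [Finset.mem_range] at hk
    rcases Nat.lt_succ_iff_lt_or_eq.1 hk with hk | rfl
    · exact hlower m hm k hk
    · exact hm
  simpa using Finset.card_le_card this

theorem IsTableau.sum_le (h : IsTableau r c) {r' : α → ℕ} {g : Equiv.Perm α}
    (hinj : Function.Injective fun t => (r' t, c (g t))) :
    ∑ t, r t ≤ ∑ t, r' t ∧
      (∑ t, r t = ∑ t, r' t → ∃ e : Equiv.Perm α, ∀ t, r (e t) = r' t ∧ c (e t) = c (g t)) := by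
  set J := Finset.univ.image c with hJ
  have hJc : ∀ t ∈ (Finset.univ : Finset α), c t ∈ J := fun t _ => by simp [hJ]
  have hJc' : ∀ t ∈ (Finset.univ : Finset α), c (g t) ∈ J := fun t _ => by simp [hJ]
  let A' : ℕ → Finset ℕ := fun j => (Finset.univ.filter fun t => c (g t) = j).image r'
  have hinjOn : ∀ j, Set.InjOn r'
      ((Finset.univ.filter fun t => c (g t) = j : Finset α) : Set α) := by
    intro j x hx y hy hxy
    simp only [Finset.coe_filter, Finset.mem_univ, true_and, Set.mem_ofPred_eq] at hx hy
    exact hinj (Prod.ext hxy (hx.trans hy.symm))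
  have hcardA : ∀ j, (A' j).card = (Finset.univ.filter fun t => c t = j).card := by
    intro j
    rw [Finset.card_image_of_injOn (hinjOn j)]
    refine Finset.card_bij (fun t _ => g t) ?_ ?_ ?_
    · intro t ht; simpa using ht
    · intro a _ b _ hab; exact g.injective hab
    · intro b hb; exact ⟨g.symm b, by simpa using hb, by simp⟩
  have hsum : ∑ t, r t = ∑ j ∈ J, ∑ x ∈ Finset.range (A' j).card, x := by
    rw [← Finset.sum_fiberwise_of_maps_to hJc]
    refine Finset.sum_congr rfl fun j _ => ?_
    rw [hcardA, ← h.image_column, Finset.sum_image]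
    intro x hx y hy hxy
    simp only [Finset.coe_filter, Finset.mem_univ, true_and, Set.mem_ofPred_eq] at hx hy
    exact h.injective (Prod.ext hxy (hx.trans hy.symm))
  have hsum' : ∑ t, r' t = ∑ j ∈ J, ∑ x ∈ A' j, x := by
    rw [← Finset.sum_fiberwise_of_maps_to hJc']
    refine Finset.sum_congr rfl fun j _ => ?_
    rw [Finset.sum_image (hinjOn j)]
  have hle : ∀ j ∈ J, ∑ x ∈ Finset.range (A' j).card, x ≤ ∑ x ∈ A' j, x := fun j _ =>
    (Nat.le_add_right _ _).trans (sum_range_add_card_le (A' j))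
  refine ⟨by rw [hsum, hsum']; exact Finset.sum_le_sum hle, fun heq => ?_⟩
  rw [hsum, hsum', Finset.sum_eq_sum_iff_of_le hle] at heq
  have hA : ∀ j ∈ J, A' j = Finset.range (A' j).card := by
    intro j hj
    have h1 := sum_range_add_card_le (A' j)
    rw [heq j hj] at h1
    have h2 : (Finset.range (A' j).card \ A' j).card = 0 := by omega
    rw [Finset.card_eq_zero, Finset.sdiff_eq_empty_iff_subset] at h2
    exact (Finset.eq_of_subset_of_card_le h2 (by simp)).symm
  have hex : ∀ t, ∃ s, r s = r' t ∧ c s = c (g t) := by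
    intro t
    have h1 : r' t ∈ A' (c (g t)) := Finset.mem_image.2 ⟨t, by simp, rfl⟩
    rw [hA _ (hJc' t (Finset.mem_univ _)), hcardA, ← h.image_column] at h1
    obtain ⟨s, hs, hs'⟩ := Finset.mem_image.1 h1
    exact ⟨s, hs', by simpa using hs⟩
  choose e he using hex
  have heinj : Function.Injective e := by
    intro x y hxy
    apply hinj
    simp only [← (he x).1, ← (he x).2, ← (he y).1, ← (he y).2, hxy]
  exact ⟨Equiv.ofBijective e (Finite.injective_iff_bijective.1 heinj), fun t => he t⟩

end Combinatorics

section YoungSymmetrizer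

variable (K : Type*) [Field K] {n : ℕ}

/-- The sum of all permutations preserving `f`. -/
noncomputable def rowSum (f : Fin n → ℕ) : MonoidAlgebra K (Equiv.Perm (Fin n)) :=
  ∑ p : stabSubgroup n f, MonoidAlgebra.single (p : Equiv.Perm (Fin n)) (1 : K)

/-- The signed sum of all permutations preserving `f`. -/
noncomputable def colSum (f : Fin n → ℕ) : MonoidAlgebra K (Equiv.Perm (Fin n)) :=
  ∑ q : stabSubgroup n f, MonoidAlgebra.single (q : Equiv.Perm (Fin n))
    ((Equiv.Perm.sign (q : Equiv.Perm (Fin n)) : ℤ) : K)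

theorem mem_stabSubgroup {f : Fin n → ℕ} {σ : Equiv.Perm (Fin n)} :
    σ ∈ stabSubgroup n f ↔ ∀ t, f (σ t) = f t := Iff.rfl

theorem swap_mem_stabSubgroup {f : Fin n → ℕ} {i j : Fin n} (h : f i = f j) :
    Equiv.swap i j ∈ stabSubgroup n f := by
  intro t
  rw [Equiv.swap_apply_def]
  split_ifs with h1 h2
  · rw [h1, h]
  · rw [h2, h]
  · rfl

theorem rowSum_mul_of {f : Fin n → ℕ} {σ : Equiv.Perm (Fin n)} (hσ : σ ∈ stabSubgroup n f) :
    rowSum K f * MonoidAlgebra.of K _ σ = rowSum K f := by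
  rw [rowSum, Finset.sum_mul]
  refine Fintype.sum_equiv (Equiv.mulRight (⟨σ, hσ⟩ : stabSubgroup n f)) _ _ fun p => ?_
  simp [MonoidAlgebra.single_mul_single]

theorem of_mul_colSum {f : Fin n → ℕ} {σ : Equiv.Perm (Fin n)} (hσ : σ ∈ stabSubgroup n f) :
    MonoidAlgebra.of K _ σ * colSum K f =
      ((Equiv.Perm.sign σ : ℤ) : K) • colSum K f := by
  rw [colSum, Finset.mul_sum, Finset.smul_sum]
  refine Fintype.sum_equiv (Equiv.mulLeft (⟨σ, hσ⟩ : stabSubgroup n f)) _ _ fun p => ?_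
  rcases Int.units_eq_one_or (Equiv.Perm.sign σ) with h | h <;>
    simp [MonoidAlgebra.single_mul_single, h]

theorem colSum_mul_of {f : Fin n → ℕ} {σ : Equiv.Perm (Fin n)} (hσ : σ ∈ stabSubgroup n f) :
    colSum K f * MonoidAlgebra.of K _ σ =
      ((Equiv.Perm.sign σ : ℤ) : K) • colSum K f := by
  rw [colSum, Finset.sum_mul, Finset.smul_sum]
  refine Fintype.sum_equiv (Equiv.mulRight (⟨σ, hσ⟩ : stabSubgroup n f)) _ _ fun p => ?_
  rcases Int.units_eq_one_or (Equiv.Perm.sign σ) with h | h <;>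
    simp [MonoidAlgebra.single_mul_single, h]

variable [CharZero K]

theorem rowSum_mul_of_mul_colSum_eq_zero {r c : Fin n → ℕ} {g : Equiv.Perm (Fin n)}
    (h : ¬ Function.Injective fun t => (r t, c (g⁻¹ t))) :
    rowSum K r * MonoidAlgebra.of K _ g * colSum K c = 0 := by
  rw [Function.not_injective_iff] at h
  obtain ⟨i, j, hij, hne⟩ := h
  simp only [Prod.mk.injEq] at hij
  have h1 := rowSum_mul_of K (swap_mem_stabSubgroup hij.1)
  have h2 := of_mul_colSum K (swap_mem_stabSubgroup hij.2)
  have h3 : Equiv.swap i j * g = g * Equiv.swap (g⁻¹ i) (g⁻¹ j) := by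
    rw [Equiv.mul_swap_eq_swap_mul]
    simp
  rw [Equiv.Perm.sign_swap (by simpa using hne)] at h2
  have h4 : rowSum K r * MonoidAlgebra.of K _ g * colSum K c =
      - (rowSum K r * MonoidAlgebra.of K _ g * colSum K c) := by
    conv_lhs => rw [← h1, mul_assoc (rowSum K r), ← map_mul, h3, map_mul, ← mul_assoc, mul_assoc,
      h2]
    simp
  have h5 : (2 : K) • (rowSum K r * MonoidAlgebra.of K _ g * colSum K c) = 0 := by
    rw [two_smul]
    nth_rewrite 1 [h4]
    exact neg_add_cancel _
  exact (smul_eq_zero.1 h5).resolve_left two_ne_zero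

theorem exists_rowSum_mul_mul_colSum {r c : Fin n → ℕ} (h : IsTableau r c)
    (x : MonoidAlgebra K (Equiv.Perm (Fin n))) :
    ∃ a : K, rowSum K r * x * colSum K c = a • (rowSum K r * colSum K c) := by
  have key : ∀ g : Equiv.Perm (Fin n), ∃ a : K,
      rowSum K r * MonoidAlgebra.of K _ g * colSum K c = a • (rowSum K r * colSum K c) := by
    intro g
    by_cases hinj : Function.Injective fun t => (r t, c (g⁻¹ t))
    · obtain ⟨e, he⟩ := (h.sum_le hinj).2 rfl
      have he1 : e⁻¹ ∈ stabSubgroup n r := inv_mem (show e ∈ _ from fun t => (he t).1)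
      have he2 : e * g ∈ stabSubgroup n c := fun t => by
        rw [Equiv.Perm.mul_apply, (he (g t)).2]; simp
      refine ⟨((Equiv.Perm.sign (e * g) : ℤ) : K), ?_⟩
      have : g = e⁻¹ * (e * g) := by group
      conv_lhs => rw [this, map_mul, ← mul_assoc, rowSum_mul_of K he1, mul_assoc,
        of_mul_colSum K he2]
      rw [mul_smul_comm]
    · exact ⟨0, by rw [rowSum_mul_of_mul_colSum_eq_zero K hinj, zero_smul]⟩
  choose a ha using key
  refine ⟨∑ g, x.coeff g * a g, ?_⟩
  conv_lhs => rw [groupAlgebra_eq_sum x]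
  rw [Finset.mul_sum, Finset.sum_mul, Finset.sum_smul]
  refine Finset.sum_congr rfl fun g _ => ?_
  rw [mul_smul_comm, smul_mul_assoc, ha, smul_smul]

theorem coeff_one_rowSum_mul_colSum {r c : Fin n → ℕ} (h : IsTableau r c) :
    (rowSum K r * colSum K c).coeff 1 = 1 := by
  classical
  simp only [rowSum, colSum, Finset.sum_mul_sum, MonoidAlgebra.single_mul_single, one_mul,
    MonoidAlgebra.coeff_sum, Finsupp.finsetSum_apply, MonoidAlgebra.coeff_single]
  rw [Finset.sum_eq_single 1, Finset.sum_eq_single 1]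
  · simp
  · intro q _ hq
    rw [Finsupp.single_eq_of_ne]
    simpa [eq_comm] using hq
  · simp
  · intro p _ hp
    refine Finset.sum_eq_zero fun q _ => ?_
    rw [Finsupp.single_eq_of_ne]
    intro hpq
    apply hp
    have hp2 : (p : Equiv.Perm (Fin n)) ∈ stabSubgroup n c := by
      rw [eq_inv_of_mul_eq_one_left hpq.symm]
      exact inv_mem q.2
    ext t : 3
    have := h.injective (a₁ := (p : Equiv.Perm (Fin n)) t) (a₂ := t)
      (Prod.ext (p.2 t) (hp2 t))
    simp [this]
  · simp

variable {ι : Type*} {r c : ι → Fin n → ℕ}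

theorem young_mul_self_ne_zero (i : ι) (h : ∀ i, IsTableau (r i) (c i)) :
    rowSum K (r i) * colSum K (c i) * (rowSum K (r i) * colSum K (c i)) ≠ 0 := by
  intro h0
  have := coeff_one_eq_zero_of_isNilpotent (K := K)
    (x := rowSum K (r i) * colSum K (c i)) ⟨2, by rw [pow_two, h0]⟩
  rw [coeff_one_rowSum_mul_colSum K (h i)] at this
  exact one_ne_zero this

theorem exists_young_mul_mul_young (i : ι) (h : ∀ i, IsTableau (r i) (c i))
    (x : MonoidAlgebra K (Equiv.Perm (Fin n))) : ∃ a : K,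
    rowSum K (r i) * colSum K (c i) * x * (rowSum K (r i) * colSum K (c i)) =
      a • (rowSum K (r i) * colSum K (c i)) := by
  obtain ⟨a, ha⟩ := exists_rowSum_mul_mul_colSum K (h i) (colSum K (c i) * x * rowSum K (r i))
  exact ⟨a, by rw [← ha]; noncomm_ring⟩

theorem young_mul_mul_young_eq_zero (h : ∀ i, IsTableau (r i) (c i))
    (hsep : ∀ i j, ∀ e : Equiv.Perm (Fin n), (∀ t, r i (e t) = r j t) → i = j)
    {i j : ι} (hij : i ≠ j) (x : MonoidAlgebra K (Equiv.Perm (Fin n))) :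
    rowSum K (r i) * colSum K (c i) * x * (rowSum K (r j) * colSum K (c j)) = 0 := by
  have key : ∀ i j, i ≠ j → ¬ (∑ t, r j t < ∑ t, r i t) →
      ∀ x, rowSum K (r i) * colSum K (c i) * x * (rowSum K (r j) * colSum K (c j)) = 0 := by
    intro i j hij hlt x
    have hz : ∀ g : Equiv.Perm (Fin n),
        rowSum K (r i) * MonoidAlgebra.of K _ g * colSum K (c j) = 0 := by
      intro g
      refine rowSum_mul_of_mul_colSum_eq_zero K fun hinj => ?_
      obtain ⟨h1, h2⟩ := (h j).sum_le hinj
      obtain ⟨e, he⟩ := h2 (le_antisymm h1 (not_lt.1 hlt))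
      exact hij (hsep j i e fun t => (he t).1).symm
    have hz' : ∀ y, rowSum K (r i) * y * colSum K (c j) = 0 := by
      intro y
      rw [groupAlgebra_eq_sum y, Finset.mul_sum, Finset.sum_mul]
      refine Finset.sum_eq_zero fun g _ => ?_
      rw [mul_smul_comm, smul_mul_assoc, hz, smul_zero]
    have := hz' (colSum K (c i) * x * rowSum K (r j))
    rw [← this]
    noncomm_ring
  by_cases hlt : ∑ t, r j t < ∑ t, r i t
  · refine eq_zero_of_forall_mul_mul_eq_zero fun y => ?_
    have h1 := key j i hij.symm (by omega) y
    set E := rowSum K (r i) * colSum K (c i)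
    set F := rowSum K (r j) * colSum K (c j)
    calc E * x * F * y * (E * x * F) = E * x * (F * y * E) * (x * F) := by noncomm_ring
      _ = 0 := by rw [h1]; simp
  · exact key i j hij hlt x

end YoungSymmetrizer

end KroneckerInvariants

namespace KroneckerInvariants

section Lists

theorem scanl_add_cons (a : ℕ) (L : List ℕ) :
    (a :: L).scanl (· + ·) 0 = 0 :: (L.scanl (· + ·) 0).map (a + ·) := by
  have key : ∀ (L : List ℕ) (b c : ℕ),
      L.scanl (· + ·) (b + c) = (L.scanl (· + ·) c).map (b + ·) := by
    intro L
    induction L with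
    | nil => simp
    | cons x L ih => intro b c; simp [List.scanl_cons, add_assoc, ih]
  have := key L a 0
  simp_all [List.scanl_cons]

theorem exists_scanl_eq_cons (L : List ℕ) : ∃ L', L.scanl (· + ·) 0 = 0 :: L' := by
  cases L <;> simp [List.scanl_cons]

theorem listBlock_cons (a : ℕ) (L : List ℕ) (t : ℕ) :
    listBlock (a :: L) t = if t < a then 0 else listBlock L (t - a) + 1 := by
  obtain ⟨L', hL'⟩ := exists_scanl_eq_cons L
  unfold listBlock
  rw [scanl_add_cons, List.tail_cons, List.countP_map, hL', List.tail_cons]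
  split_ifs with h
  · rw [List.countP_eq_zero]
    intro s _
    simp only [Function.comp_apply, decide_eq_true_eq]
    omega
  · rw [List.countP_cons_of_pos (by simpa using h)]
    congr 1
    refine List.countP_congr fun s _ => ?_
    simp only [Function.comp_apply, decide_eq_true_eq]
    omega

theorem max_foldr_map_add (a : ℕ) (L : List ℕ) :
    max a ((L.map (a + ·)).foldr max 0) = a + L.foldr max 0 := by
  induction L with
  | nil => simp
  | cons x L ih =>
    simp only [List.map_cons, List.foldr_cons]
    rw [max_left_comm, ih]
    omega

theorem listCol_cons (a : ℕ) (L : List ℕ) (t : ℕ) :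
    listCol (a :: L) t = if t < a then t else listCol L (t - a) := by
  obtain ⟨L', hL'⟩ := exists_scanl_eq_cons L
  unfold listCol
  rw [scanl_add_cons, List.filter_cons_of_pos (by simp), List.filter_map]
  split_ifs with h
  · have : (L.scanl (· + ·) 0).filter ((fun s => decide (s ≤ t)) ∘ (a + ·)) = [] := by
      rw [List.filter_eq_nil_iff]
      intro s _
      simp only [Function.comp_apply, decide_eq_true_eq]
      omega
    rw [this]
    simp
  · have : (L.scanl (· + ·) 0).filter ((fun s => decide (s ≤ t)) ∘ (a + ·)) =
        (L.scanl (· + ·) 0).filter fun s => decide (s ≤ t - a) := by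
      refine List.filter_congr fun s _ => ?_
      simp only [Function.comp_apply, decide_eq_decide]
      omega
    rw [this, hL', List.filter_cons_of_pos (by simp), List.map_cons]
    simp only [List.foldr_cons, add_zero, max_foldr_map_add]
    omega

theorem listCol_lt {L : List ℕ} {a : ℕ} (h : ∀ x ∈ L, x ≤ a) {t : ℕ} (ht : t < L.sum) :
    listCol L t < a := by
  induction L generalizing t with
  | nil => simp at ht
  | cons x L ih =>
    rw [listCol_cons]
    rw [List.sum_cons] at ht
    have := h x (by simp)
    split_ifs with hx
    · omega
    · exact ih (fun y hy => h y (by simp [hy])) (by omega)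

theorem listBlock_listCol_inj {L : List ℕ} {s t : ℕ}
    (hs : s < L.sum) (ht : t < L.sum) (hb : listBlock L s = listBlock L t)
    (hc : listCol L s = listCol L t) : s = t := by
  induction L generalizing s t with
  | nil => simp at hs
  | cons x L ih =>
    rw [List.sum_cons] at hs ht
    simp only [listBlock_cons, listCol_cons] at hb hc
    by_cases h1 : s < x <;> by_cases h2 : t < x <;> simp only [h1, h2, if_true, if_false] at hb hc
    · exact hc
    · omega
    · omega
    · have := ih (by omega) (by omega) (by omega) hc
      omega

theorem exists_listBlock_eq {L : List ℕ} (hL : L.Pairwise (· ≥ ·)) {t k : ℕ} (ht : t < L.sum)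
    (hk : k < listBlock L t) : ∃ s < L.sum, listBlock L s = k ∧ listCol L s = listCol L t := by
  induction L generalizing t k with
  | nil => simp at ht
  | cons x L ih =>
    rw [List.pairwise_cons] at hL
    rw [List.sum_cons] at ht ⊢
    rw [listBlock_cons] at hk
    split_ifs at hk with h
    · omega
    · have ht' : t - x < L.sum := by omega
      rw [listCol_cons x L t, if_neg h]
      rcases k with _ | k
      · have := listCol_lt hL.1 ht'
        exact ⟨listCol L (t - x), by omega, by rw [listBlock_cons, if_pos this],
          by rw [listCol_cons, if_pos this]⟩
      · obtain ⟨s, hs, h1, h2⟩ := ih hL.2 ht' (by omega : k < _)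
        refine ⟨x + s, by omega, ?_, ?_⟩
        · rw [listBlock_cons, if_neg (by omega), Nat.add_sub_cancel_left, h1]
        · rw [listCol_cons, if_neg (by omega), Nat.add_sub_cancel_left, h2]

theorem listBlock_lt_length {L : List ℕ} {t : ℕ} (ht : t < L.sum) : listBlock L t < L.length := by
  induction L generalizing t with
  | nil => simp at ht
  | cons x L ih =>
    rw [List.sum_cons] at ht
    rw [listBlock_cons, List.length_cons]
    split_ifs with h
    · omega
    · have := ih (t := t - x) (by omega)
      omega

theorem exists_listCol_eq_zero {L : List ℕ} (hL : ∀ x ∈ L, 0 < x) {k : ℕ} (hk : k < L.length) :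
    ∃ t < L.sum, listBlock L t = k ∧ listCol L t = 0 := by
  induction L generalizing k with
  | nil => simp at hk
  | cons x L ih =>
    have hx := hL x (by simp)
    rw [List.sum_cons]
    rcases k with _ | k
    · exact ⟨0, by omega, by rw [listBlock_cons, if_pos hx], by rw [listCol_cons, if_pos hx]⟩
    · rw [List.length_cons] at hk
      obtain ⟨t, ht, h1, h2⟩ := ih (fun y hy => hL y (by simp [hy])) (by omega : k < _)
      refine ⟨x + t, by omega, ?_, ?_⟩
      · rw [listBlock_cons, if_neg (by omega), Nat.add_sub_cancel_left, h1]
      · rw [listCol_cons, if_neg (by omega), Nat.add_sub_cancel_left, h2]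

theorem sum_listBlock_eq (L : List ℕ) (k : ℕ) :
    ∑ t ∈ Finset.range L.sum, (if listBlock L t = k then 1 else 0) = L.getD k 0 := by
  induction L generalizing k with
  | nil => simp
  | cons x L ih =>
    rw [List.sum_cons, Finset.sum_range_add]
    have h1 : ∑ t ∈ Finset.range x, (if listBlock (x :: L) t = k then 1 else 0) =
        if k = 0 then x else 0 := by
      rw [Finset.sum_congr rfl (g := fun _ => if k = 0 then 1 else 0)]
      · simp
      · intro t ht
        rw [listBlock_cons, if_pos (Finset.mem_range.1 ht)]
        simp [eq_comm]
    have h2 : ∀ t, listBlock (x :: L) (x + t) = listBlock L t + 1 := fun t => by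
      rw [listBlock_cons, if_neg (by omega), Nat.add_sub_cancel_left]
    rw [h1]
    simp only [h2]
    rcases k with _ | k
    · simp
    · simpa using ih k

theorem list_eq_of_getD_eq {L L' : List ℕ} (hL : ∀ x ∈ L, 0 < x) (hL' : ∀ x ∈ L', 0 < x)
    (h : ∀ k, L.getD k 0 = L'.getD k 0) : L = L' := by
  induction L generalizing L' with
  | nil =>
    cases L' with
    | nil => rfl
    | cons y L' => have := h 0; have := hL' y (by simp); simp at *; omega
  | cons x L ih =>
    cases L' with
    | nil => have := h 0; have := hL x (by simp); simp at *; omega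
    | cons y L' =>
      have h0 := h 0
      simp only [List.getD_cons_zero] at h0
      have := ih (L' := L') (fun z hz => hL z (by simp [hz])) (fun z hz => hL' z (by simp [hz]))
        fun k => by simpa using h (k + 1)
      rw [h0, this]

end Lists

section Partition

variable {n : ℕ}

theorem partsList_coe (lam : Nat.Partition n) : (partsList lam : Multiset ℕ) = lam.parts := by
  rw [partsList, Multiset.coe_reverse, Multiset.sort_eq]

theorem partsList_sum (lam : Nat.Partition n) : (partsList lam).sum = n := by
  rw [← Multiset.sum_coe, partsList_coe, lam.parts_sum]

theorem partsList_length (lam : Nat.Partition n) : (partsList lam).length = lam.parts.card := by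
  rw [← Multiset.coe_card, partsList_coe]

theorem partsList_pos (lam : Nat.Partition n) : ∀ x ∈ partsList lam, 0 < x := fun x hx =>
  lam.parts_pos (by rwa [← partsList_coe])

theorem partsList_pairwise (lam : Nat.Partition n) : (partsList lam).Pairwise (· ≥ ·) := by
  rw [partsList, List.pairwise_reverse]
  exact Multiset.pairwise_sort lam.parts (· ≤ ·)

/-- The row function of the canonical tableau of `lam`. -/
def rowFn (lam : Nat.Partition n) (t : Fin n) : ℕ := listBlock (partsList lam) t

/-- The column function of the canonical tableau of `lam`. -/
def colFn (lam : Nat.Partition n) (t : Fin n) : ℕ := listCol (partsList lam) t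

theorem isTableau (lam : Nat.Partition n) : IsTableau (rowFn lam) (colFn lam) where
  injective s t h := by
    simp only [Prod.mk.injEq] at h
    refine Fin.ext (listBlock_listCol_inj (L := partsList lam) ?_ ?_ h.1 h.2) <;>
      simp [partsList_sum]
  exists_above t k hk := by
    obtain ⟨s, hs, h⟩ := exists_listBlock_eq (partsList_pairwise lam) (by simp [partsList_sum]) hk
    rw [partsList_sum] at hs
    exact ⟨⟨s, hs⟩, h⟩

theorem rowFn_lt (lam : Nat.Partition n) (t : Fin n) : rowFn lam t < lam.parts.card := by
  rw [← partsList_length]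
  exact listBlock_lt_length (by simp [partsList_sum])

theorem exists_colFn_eq_zero (lam : Nat.Partition n) (k : Fin lam.parts.card) :
    ∃ t, rowFn lam t = k ∧ colFn lam t = 0 := by
  obtain ⟨t, ht, h⟩ := exists_listCol_eq_zero (partsList_pos lam)
    (by rw [partsList_length]; exact k.2)
  rw [partsList_sum] at ht
  exact ⟨⟨t, ht⟩, h⟩

theorem eq_of_rowFn_comp_eq (lam mu : Nat.Partition n) (e : Equiv.Perm (Fin n))
    (h : ∀ t, rowFn lam (e t) = rowFn mu t) : lam = mu := by
  have key : ∀ lam : Nat.Partition n, ∀ k,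
      (partsList lam).getD k 0 = ∑ t : Fin n, if rowFn lam t = k then 1 else 0 := by
    intro lam k
    rw [← sum_listBlock_eq, partsList_sum, Finset.sum_range]
    rfl
  have := list_eq_of_getD_eq (partsList_pos lam) (partsList_pos mu) fun k => by
    rw [key, key, ← Equiv.sum_comp e]
    simp only [h]
  refine Nat.Partition.ext ?_
  rw [← partsList_coe, this, partsList_coe]

theorem blockYoungSymmetrizer_eq (K : Type) [Field K] (lam : Nat.Partition n) :
    blockYoungSymmetrizer K n 0 n lam = rowSum K (rowFn lam) * colSum K (colFn lam) := by
  have h1 : shiftedRowFn n 0 n lam = fun t => n + rowFn lam t := by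
    funext t
    simp [shiftedRowFn, rowFn]
  have h2 : shiftedColFn n 0 n lam = fun t => n + colFn lam t := by
    funext t
    simp [shiftedColFn, colFn]
  have key : ∀ f : Fin n → ℕ, stabSubgroup n (fun t => n + f t) = stabSubgroup n f := by
    intro f
    ext σ
    simp [mem_stabSubgroup]
  rw [blockYoungSymmetrizer, rowSum, colSum, h1, h2]
  congr 1
  · exact Fintype.sum_equiv (Equiv.subtypeEquivRight fun σ => by rw [key]) _ _ fun p => rfl
  · exact Fintype.sum_equiv (Equiv.subtypeEquivRight fun σ => by rw [key]) _ _ fun p => rfl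

end Partition

section ConjClasses

theorem card_conjClasses_perm_le (n : ℕ) :
    Nat.card (ConjClasses (Equiv.Perm (Fin n))) ≤ Fintype.card (Nat.Partition n) := by
  let f : ConjClasses (Equiv.Perm (Fin n)) → Nat.Partition (Fintype.card (Fin n)) :=
    Quotient.lift (fun σ : Equiv.Perm (Fin n) => σ.partition) fun σ τ h =>
      Equiv.Perm.partition_eq_of_isConj.1 h
  have hf : Function.Injective f := by
    rintro ⟨σ⟩ ⟨τ⟩ h
    exact Quotient.sound (Equiv.Perm.partition_eq_of_isConj.2 h)
  have := Nat.card_le_card_of_injective f hf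
  rwa [Nat.card_eq_fintype_card (α := Nat.Partition _), Fintype.card_fin] at this

end ConjClasses

end KroneckerInvariants

namespace KroneckerInvariants

open Representation

theorem intertwiningMap_asAlgebraHom {K G V W : Type*} [Field K] [Group G] [Fintype G]
    [AddCommGroup V] [Module K V] [AddCommGroup W] [Module K W] {ρ : Representation K G V}
    {σ : Representation K G W} (f : IntertwiningMap ρ σ) (x : MonoidAlgebra K G) (v : V) :
    f.toLinearMap (ρ.asAlgebraHom x v) = σ.asAlgebraHom x (f.toLinearMap v) := by
  rw [groupAlgebra_eq_sum x]
  simp only [map_sum, map_smul, asAlgebraHom_of, LinearMap.sum_apply, LinearMap.smul_apply]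
  refine Finset.sum_congr rfl fun g _ => ?_
  exact congrArg _ (LinearMap.congr_fun (f.isIntertwining' g) v)

section Idempotents

variable {K G ι : Type*} [Field K] [Group G] [Fintype G] {S : ι → Type*}
  [∀ i, AddCommGroup (S i)] [∀ i, Module K (S i)] (ρ : ∀ i, Representation K G (S i))
  (v : ∀ i, S i) (e : ι → MonoidAlgebra K G)
  (hcyc : ∀ i w, ∃ x, w = (ρ i).asAlgebraHom x (v i))
  (hann : ∀ i x, (ρ i).asAlgebraHom x (v i) = 0 ↔ x * e i = 0)

include hcyc in
theorem finiteDimensional_of_cyclic (i : ι) : FiniteDimensional K (S i) := by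
  have : FiniteDimensional K (MonoidAlgebra K G) := (groupBasis K G).finiteDimensional_of_finite
  refine Module.Finite.of_surjective
    ((LinearMap.applyₗ (v i)).comp (ρ i).asAlgebraHom.toLinearMap) fun w => ?_
  obtain ⟨x, hx⟩ := hcyc i w
  exact ⟨x, hx.symm⟩

variable (h0 : ∀ i j, i ≠ j → ∀ x, e i * x * e j = 0) (h1 : ∀ i x, ∃ a : K, e i * x * e i = a • e i)
  (h2 : ∀ i, e i * e i ≠ 0)

omit [Fintype G] in
include hcyc hann h0 h2 in
theorem asAlgebraHom_eq_zero_iff_ne (i j : ι) : (ρ j).asAlgebraHom (e i) = 0 ↔ i ≠ j := by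
  constructor
  · rintro h rfl
    exact h2 i ((hann i _).1 (by rw [h]; rfl))
  · intro hij
    ext w
    obtain ⟨x, rfl⟩ := hcyc j w
    rw [← Module.End.mul_apply, ← map_mul, (hann j _).2 (h0 i j hij x)]
    rfl

include hcyc hann h0 h1 h2 in
theorem finrank_intertwiningMap_eq_ite [DecidableEq ι] (i j : ι) :
    Module.finrank K (IntertwiningMap (ρ i) (ρ j)) = if i = j then 1 else 0 := by
  obtain ⟨a, ha⟩ := h1 i 1
  rw [mul_one] at ha
  have ha0 : a ≠ 0 := by
    rintro rfl
    exact h2 i (by rw [ha, zero_smul])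
  have hv : (ρ i).asAlgebraHom (e i) (v i) = a • v i := by
    have := (hann i (e i - a • 1)).2 (by rw [sub_mul, smul_mul_assoc, one_mul, ha, sub_self])
    rwa [map_sub, map_smul, map_one, LinearMap.sub_apply, LinearMap.smul_apply,
      Module.End.one_apply, sub_eq_zero] at this
  have hf : ∀ f : IntertwiningMap (ρ i) (ρ j),
      f.toLinearMap (v i) = a⁻¹ • (ρ j).asAlgebraHom (e i) (f.toLinearMap (v i)) := by
    intro f
    rw [← intertwiningMap_asAlgebraHom, hv, map_smul, smul_smul, inv_mul_cancel₀ ha0, one_smul]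
  have hext : ∀ f g : IntertwiningMap (ρ i) (ρ j), f.toLinearMap (v i) = g.toLinearMap (v i) →
      f = g := by
    intro f g hfg
    refine IntertwiningMap.ext (LinearMap.ext fun w => ?_)
    obtain ⟨x, rfl⟩ := hcyc i w
    rw [intertwiningMap_asAlgebraHom, intertwiningMap_asAlgebraHom, hfg]
  split_ifs with hij
  · subst hij
    refine finrank_eq_one_iff'.2 ⟨IntertwiningMap.id (ρ i), fun hid => ?_, fun f => ?_⟩
    · have hv0 : v i = 0 :=
        congrArg (fun f : IntertwiningMap (ρ i) (ρ i) => f.toLinearMap (v i)) hid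
      refine h2 i ?_
      rw [← hann i, hv0, map_zero]
    · obtain ⟨x, hx⟩ := hcyc i (f.toLinearMap (v i))
      obtain ⟨b, hb⟩ := h1 i x
      refine ⟨a⁻¹ * b, hext _ _ (Eq.symm ?_)⟩
      have : (ρ i).asAlgebraHom (e i * x) (v i) = b • v i := by
        have := (hann i (e i * x - b • 1)).2 (by
          rw [sub_mul, smul_mul_assoc, one_mul, hb, sub_self])
        rwa [map_sub, map_smul, map_one, LinearMap.sub_apply, LinearMap.smul_apply,
          Module.End.one_apply, sub_eq_zero] at this
      rw [hf f, hx, ← Module.End.mul_apply, ← map_mul, this, smul_smul]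
      rfl
  · have : Subsingleton (IntertwiningMap (ρ i) (ρ j)) := by
      refine ⟨fun f g => hext f g ?_⟩
      rw [hf f, hf g, (asAlgebraHom_eq_zero_iff_ne ρ v e hcyc hann h0 h2 i j).2 hij]
      rfl
    exact Module.finrank_zero_of_subsingleton

end Idempotents

section Specht

variable (K : Type) [Field K] {n : ℕ}

/-- The representation of the symmetric group on the Specht module of `lam`. -/
noncomputable abbrev spechtRep (lam : Nat.Partition n) :
    Representation K (Equiv.Perm (Fin n)) (specht K n lam).V := (specht K n lam).ρ

/-- The Young symmetrizer of the canonical tableau of `lam`. -/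
noncomputable def young (lam : Nat.Partition n) : MonoidAlgebra K (Equiv.Perm (Fin n)) :=
  rowSum K (rowFn lam) * colSum K (colFn lam)

/-- The generator of the Specht module. -/
noncomputable def spechtVector (lam : Nat.Partition n) : (specht K n lam).V :=
  (RestrictScalars.addEquiv K (MonoidAlgebra K (Equiv.Perm (Fin n))) _).symm
    (⟨blockYoungSymmetrizer K n 0 n lam, Submodule.subset_span rfl⟩ : spechtIdeal K n lam)

theorem spechtRep_asAlgebraHom_spechtVector (lam : Nat.Partition n)
    (x : MonoidAlgebra K (Equiv.Perm (Fin n))) :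
    (spechtRep K lam).asAlgebraHom x (spechtVector K lam) =
      (RestrictScalars.addEquiv K (MonoidAlgebra K (Equiv.Perm (Fin n))) _).symm
    (x • (⟨blockYoungSymmetrizer K n 0 n lam, Submodule.subset_span rfl⟩ :
      spechtIdeal K n lam)) :=
  ofModule_asAlgebraHom_apply_apply (spechtIdeal K n lam) x (spechtVector K lam)

theorem exists_eq_spechtRep (lam : Nat.Partition n) (w : (specht K n lam).V) :
    ∃ x, w = (spechtRep K lam).asAlgebraHom x (spechtVector K lam) := by
  let E := RestrictScalars.addEquiv K (MonoidAlgebra K (Equiv.Perm (Fin n))) (spechtIdeal K n lam)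
  obtain ⟨x, hx⟩ := Submodule.mem_span_singleton.1 (E w).2
  refine ⟨x, ?_⟩
  rw [spechtRep_asAlgebraHom_spechtVector]
  refine (E.eq_symm_apply).2 (Subtype.ext hx.symm)

theorem spechtRep_eq_zero_iff (lam : Nat.Partition n) (x : MonoidAlgebra K (Equiv.Perm (Fin n))) :
    (spechtRep K lam).asAlgebraHom x (spechtVector K lam) = 0 ↔ x * young K lam = 0 := by
  rw [spechtRep_asAlgebraHom_spechtVector, young, ← blockYoungSymmetrizer_eq]
  exact (AddEquiv.map_eq_zero_iff _).trans Subtype.ext_iff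

instance (lam : Nat.Partition n) : FiniteDimensional K (specht K n lam).V :=
  finiteDimensional_of_cyclic (spechtRep K) (spechtVector K) (exists_eq_spechtRep K) lam

variable [CharZero K]

theorem young_mul_mul_young (lam mu : Nat.Partition n) (h : lam ≠ mu)
    (x : MonoidAlgebra K (Equiv.Perm (Fin n))) : young K lam * x * young K mu = 0 :=
  young_mul_mul_young_eq_zero K isTableau eq_of_rowFn_comp_eq h x

theorem spechtRep_young_eq_zero_iff (lam mu : Nat.Partition n) :
    (spechtRep K mu).asAlgebraHom (young K lam) = 0 ↔ lam ≠ mu :=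
  asAlgebraHom_eq_zero_iff_ne (spechtRep K) (spechtVector K) (young K) (exists_eq_spechtRep K)
    (spechtRep_eq_zero_iff K) (young_mul_mul_young K)
    (fun lam => young_mul_self_ne_zero K lam isTableau) lam mu

theorem finrank_spechtRep_intertwiningMap (lam mu : Nat.Partition n) :
    Module.finrank K (IntertwiningMap (spechtRep K lam) (spechtRep K mu)) =
      if lam = mu then 1 else 0 :=
  finrank_intertwiningMap_eq_ite (spechtRep K) (spechtVector K) (young K) (exists_eq_spechtRep K)
    (spechtRep_eq_zero_iff K) (young_mul_mul_young K)
    (fun lam => exists_young_mul_mul_young K lam isTableau)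
    (fun lam => young_mul_self_ne_zero K lam isTableau) lam mu

omit [CharZero K] in
theorem kron_eq (lam mu nu : Nat.Partition n) :
    kron K lam mu nu = Module.finrank K
      (IntertwiningMap (spechtRep K nu) ((spechtRep K lam).tprod (spechtRep K mu))) :=
  (Rep.homLinearEquiv (specht K n nu) (specht K n lam ⊗ specht K n mu)).finrank_eq

theorem finrank_tprod_self (lam mu : Nat.Partition n) :
    Module.finrank K (IntertwiningMap ((spechtRep K lam).tprod (spechtRep K mu))
      ((spechtRep K lam).tprod (spechtRep K mu))) = ∑ nu, kron K lam mu nu ^ 2 := by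
  simp_rw [kron_eq]
  exact finrank_intertwiningMap_self (spechtRep K) (finrank_spechtRep_intertwiningMap K)
    (card_conjClasses_perm_le n) _

theorem sum_finrank_mul_character_specht (g : Equiv.Perm (Fin n)) :
    ∑ lam : Nat.Partition n, (Module.finrank K (specht K n lam).V : K) *
      (spechtRep K lam).character g =
      if g = 1 then (Fintype.card (Equiv.Perm (Fin n)) : K) else 0 :=
  sum_finrank_mul_character (spechtRep K) (finrank_spechtRep_intertwiningMap K)
    (card_conjClasses_perm_le n) g

end Specht

end KroneckerInvariants

namespace KroneckerInvariants

open Representation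

section ExternalTensor

theorem tensorProduct_map_eq_zero_iff {K A B : Type*} [Field K] [AddCommGroup A] [Module K A]
    [AddCommGroup B] [Module K B] (f : Module.End K A) (g : Module.End K B) :
    TensorProduct.map f g = 0 ↔ f = 0 ∨ g = 0 := by
  constructor
  · intro h
    by_contra! hfg
    obtain ⟨v, hv⟩ := DFunLike.ne_iff.1 hfg.1
    obtain ⟨w, hw⟩ := DFunLike.ne_iff.1 hfg.2
    have hφ := mt (Module.forall_dual_apply_eq_zero_iff K (f v)).1 hv
    have hψ := mt (Module.forall_dual_apply_eq_zero_iff K (g w)).1 hw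
    push Not at hφ hψ
    obtain ⟨φ, hφ⟩ := hφ
    obtain ⟨ψ, hψ⟩ := hψ
    have h1 := congrArg (fun F => TensorProduct.lid K K
      (TensorProduct.map φ ψ (F (TensorProduct.tmul K v w)))) h
    simp only [TensorProduct.map_tmul, TensorProduct.lid_tmul, LinearMap.zero_apply, map_zero,
      smul_eq_mul, mul_eq_zero] at h1
    exact h1.elim hφ hψ
  · rintro (rfl | rfl)
    · exact TensorProduct.map_zero_left _
    · exact TensorProduct.map_zero_right _

variable {K G H A B : Type*} [Field K] [Group G] [Fintype G] [Group H] [Fintype H]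
  [AddCommGroup A] [Module K A] [AddCommGroup B] [Module K B]

/-- The external tensor product of two representations. -/
noncomputable def boxProd (ρ : Representation K G A) (σ : Representation K H B) :
    Representation K (G × H) (TensorProduct K A B) :=
  Representation.tprod (MonoidHom.comp ρ (MonoidHom.fst G H))
    (MonoidHom.comp σ (MonoidHom.snd G H))

/-- The element `x ⊗ y` of the group algebra of `G × H`. -/
noncomputable def boxElt (x : MonoidAlgebra K G) (y : MonoidAlgebra K H) :
    MonoidAlgebra K (G × H) :=
  ∑ g, ∑ h, (x.coeff g * y.coeff h) • MonoidAlgebra.of K (G × H) (g, h)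

theorem boxProd_asAlgebraHom (ρ : Representation K G A) (σ : Representation K H B)
    (x : MonoidAlgebra K G) (y : MonoidAlgebra K H) :
    (boxProd ρ σ).asAlgebraHom (boxElt x y) =
      TensorProduct.map (ρ.asAlgebraHom x) (σ.asAlgebraHom y) := by
  refine TensorProduct.ext' fun v w => ?_
  conv_rhs => rw [groupAlgebra_eq_sum x, groupAlgebra_eq_sum y]
  simp only [boxElt, map_sum, map_smul, asAlgebraHom_of, LinearMap.sum_apply,
    LinearMap.smul_apply, TensorProduct.map_tmul, TensorProduct.sum_tmul, TensorProduct.tmul_sum,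
    TensorProduct.smul_tmul_smul]
  rw [Finset.sum_comm]
  rfl

omit [Fintype G] [Fintype H] in
theorem boxProd_character [FiniteDimensional K A] [FiniteDimensional K B]
    (ρ : Representation K G A) (σ : Representation K H B) (g : G) (h : H) :
    (boxProd ρ σ).character (g, h) = ρ.character g * σ.character h := by
  rw [boxProd, char_tensor]
  rfl

end ExternalTensor

section SpechtBox

variable (K : Type) [Field K] [CharZero K] {n : ℕ}

/-- The irreducible representations of `Sₙ × Sₙ`. -/
noncomputable def spechtBox (p : Nat.Partition n × Nat.Partition n) :
    Representation K (Equiv.Perm (Fin n) × Equiv.Perm (Fin n))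
      (TensorProduct K (specht K n p.1).V (specht K n p.2).V) :=
  boxProd (spechtRep K p.1) (spechtRep K p.2)

omit [CharZero K] in
theorem spechtBox_comp_diag (p : Nat.Partition n × Nat.Partition n) :
    MonoidHom.comp (spechtBox K p) (MonoidHom.prod (MonoidHom.id _) (MonoidHom.id _)) =
      (spechtRep K p.1).tprod (spechtRep K p.2) := rfl

theorem spechtBox_boxElt_eq_zero_iff (p q : Nat.Partition n × Nat.Partition n) :
    (spechtBox K q).asAlgebraHom (boxElt (young K p.1) (young K p.2)) = 0 ↔ p ≠ q := by
  rw [spechtBox, boxProd_asAlgebraHom, tensorProduct_map_eq_zero_iff,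
    spechtRep_young_eq_zero_iff, spechtRep_young_eq_zero_iff, Ne, Ne, Ne, Prod.ext_iff]
  tauto

theorem sum_finrank_mul_character_spechtBox (g : Equiv.Perm (Fin n) × Equiv.Perm (Fin n)) :
    ∑ p : Nat.Partition n × Nat.Partition n,
      (Module.finrank K (TensorProduct K (specht K n p.1).V (specht K n p.2).V) : K) *
      (spechtBox K p).character g =
      if g = 1 then (Fintype.card (Equiv.Perm (Fin n) × Equiv.Perm (Fin n)) : K) else 0 := by
  obtain ⟨g, h⟩ := g
  have h1 : ∀ p : Nat.Partition n × Nat.Partition n,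
      (Module.finrank K (TensorProduct K (specht K n p.1).V (specht K n p.2).V) : K) *
      (spechtBox K p).character (g, h) =
      ((Module.finrank K (specht K n p.1).V : K) * (spechtRep K p.1).character g) *
      ((Module.finrank K (specht K n p.2).V : K) * (spechtRep K p.2).character h) := by
    intro p
    rw [spechtBox, boxProd_character, Module.finrank_tensorProduct]
    push_cast
    ring
  rw [Finset.sum_congr rfl fun p _ => h1 p, Fintype.sum_prod_type]
  refine (Finset.sum_mul_sum _ _
    (fun p => (Module.finrank K (specht K n p).V : K) * (spechtRep K p).character g)
    (fun p => (Module.finrank K (specht K n p).V : K) * (spechtRep K p).character h)).symm.trans ?_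
  rw [sum_finrank_mul_character_specht, sum_finrank_mul_character_specht, Fintype.card_prod]
  by_cases hg : g = 1 <;> by_cases hh : h = 1 <;> simp [hg, hh]

theorem finrank_range_commuting_diag {B : Type*} [Ring B] [Algebra K B]
    (Ψ : MonoidAlgebra K (Equiv.Perm (Fin n) × Equiv.Perm (Fin n)) →ₐ[K] B) (a b : ℕ)
    (hΨ : ∀ lam mu : Nat.Partition n, Ψ (boxElt (young K lam) (young K mu)) ≠ 0 ↔
      lam.parts.card ≤ a ∧ mu.parts.card ≤ b) (C : Submodule K B)
    (hC : ∀ T, T ∈ C ↔ T ∈ Ψ.range ∧ ∀ s, T * Ψ (MonoidAlgebra.of K _ (s, s)) =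
      Ψ (MonoidAlgebra.of K _ (s, s)) * T) :
    Module.finrank K C =
      ∑ lam : Nat.Partition n, ∑ mu : Nat.Partition n, ∑ nu : Nat.Partition n,
        if lam.parts.card ≤ a ∧ mu.parts.card ≤ b then kron K lam mu nu ^ 2 else 0 := by
  classical
  rw [finrank_range_commuting (spechtBox K) (sum_finrank_mul_character_spechtBox K) Ψ
    (fun p => boxElt (young K p.1) (young K p.2)) (spechtBox_boxElt_eq_zero_iff K)
    (MonoidHom.prod (MonoidHom.id _) (MonoidHom.id _)) C hC, Fintype.sum_prod_type]
  refine Finset.sum_congr rfl fun lam _ => Finset.sum_congr rfl fun mu _ => ?_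
  have h1 := finrank_tprod_self K lam mu
  rw [← spechtBox_comp_diag K (lam, mu)] at h1
  rw [h1]
  simp only [hΨ]
  split_ifs with h
  · rfl
  · exact Finset.sum_const_zero.symm

end SpechtBox

end KroneckerInvariants

namespace KroneckerInvariants

section DoubleCommutant

theorem mem_range_of_forall_commute {K G Z : Type*} [Field K] [CharZero K] [Group G] [Fintype G]
    [Fintype Z] [DecidableEq Z] (A : MonoidAlgebra K G →ₐ[K] Matrix Z Z K) (T : Matrix Z Z K)
    (hT : ∀ N, (∀ g, N * A (MonoidAlgebra.of K G g) = A (MonoidAlgebra.of K G g) * N) →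
      T * N = N * T) : T ∈ A.range := by
  have : NeZero (Nat.card G : K) := ⟨by simp⟩
  let φ : MonoidAlgebra K G →ₐ[K] Module.End K (Z → K) :=
    (Matrix.toLinAlgEquiv' : Matrix Z Z K ≃ₐ[K] _).toAlgHom.comp A
  let inst : Module (MonoidAlgebra K G) (Z → K) := Module.compHom _ φ.toRingHom
  have hsmul : ∀ (x : MonoidAlgebra K G) (m : Z → K), x • m = (A x).mulVec m := fun x m => rfl
  have hcomm : ∀ (e : Module.End (MonoidAlgebra K G) (Z → K)) (m : Z → K),
      T.mulVec (e m) = e (T.mulVec m) := by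
    intro e
    let e' : (Z → K) →ₗ[K] (Z → K) :=
      { toFun := e
        map_add' := e.map_add
        map_smul' := fun c m => by
          have h := e.map_smul (algebraMap K (MonoidAlgebra K G) c) m
          rw [hsmul, hsmul, AlgHom.commutes] at h
          simpa only [Algebra.algebraMap_eq_smul_one, Matrix.smul_mulVec, Matrix.one_mulVec,
            RingHom.id_apply] using h }
    have hN : ∀ m, (LinearMap.toMatrix' e').mulVec m = e m := fun m =>
      LinearMap.toMatrix'_mulVec e' m
    have := hT (LinearMap.toMatrix' e') fun g => by
      refine Matrix.ext_of_mulVec_single fun i => ?_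
      rw [← Matrix.mulVec_mulVec, ← Matrix.mulVec_mulVec, hN, hN, ← hsmul, ← hsmul, map_smul]
    intro m
    rw [← hN, ← hN, Matrix.mulVec_mulVec, Matrix.mulVec_mulVec, this]
  let f : Module.End (Module.End (MonoidAlgebra K G) (Z → K)) (Z → K) :=
    { toFun := T.mulVec
      map_add' := Matrix.mulVec_add T
      map_smul' := hcomm }
  classical
  obtain ⟨x, hx⟩ := jacobson_density f (Finset.univ.image fun i : Z => Pi.single i (1 : K))
  refine ⟨x, Matrix.ext_of_mulVec_single fun i => ?_⟩
  exact (hx (Pi.single i 1) (by simp)).symm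

end DoubleCommutant

section PermutationMatrices

variable (K : Type*) {G Z : Type*} [Field K] [Group G] [Fintype Z] [DecidableEq Z]

/-- The algebra homomorphism from the group algebra to matrices given by the permutation matrices
of an action. -/
noncomputable def permAlgHom (act : G →* Equiv.Perm Z) : MonoidAlgebra K G →ₐ[K] Matrix Z Z K :=
  MonoidAlgebra.lift K (Matrix Z Z K) G
    { toFun := fun g => Matrix.of fun z w => if z = act g w then 1 else 0
      map_one' := by
        ext z w
        simp [Matrix.one_apply]
      map_mul' := fun g h => by
        ext z w
        simp [Matrix.mul_apply] }

variable {K} (act : G →* Equiv.Perm Z)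

theorem permAlgHom_of (g : G) (z w : Z) :
    permAlgHom K act (MonoidAlgebra.of K G g) z w = if z = act g w then 1 else 0 := by
  simp [permAlgHom]

theorem mul_permAlgHom_of (N : Matrix Z Z K) (g : G) (z w : Z) :
    (N * permAlgHom K act (MonoidAlgebra.of K G g)) z w = N z (act g w) := by
  simp only [Matrix.mul_apply, permAlgHom_of]
  simp

theorem permAlgHom_of_mul (N : Matrix Z Z K) (g : G) (z w : Z) :
    (permAlgHom K act (MonoidAlgebra.of K G g) * N) (act g z) w = N z w := by
  simp only [Matrix.mul_apply, permAlgHom_of]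
  simp

theorem commute_permAlgHom_iff (N : Matrix Z Z K) (g : G) :
    N * permAlgHom K act (MonoidAlgebra.of K G g) = permAlgHom K act (MonoidAlgebra.of K G g) * N ↔
      ∀ z w, N (act g z) (act g w) = N z w := by
  constructor
  · intro h z w
    rw [← mul_permAlgHom_of act N g, h, permAlgHom_of_mul]
  · intro h
    ext z w
    obtain ⟨z, rfl⟩ := (act g).surjective z
    rw [mul_permAlgHom_of, permAlgHom_of_mul, h]

theorem permAlgHom_apply [Fintype G] (x : MonoidAlgebra K G) (z w : Z) :
    permAlgHom K act x z w = ∑ g, x.coeff g * if z = act g w then 1 else 0 := by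
  conv_lhs => rw [groupAlgebra_eq_sum x]
  simp only [map_sum, map_smul, Matrix.sum_apply, Matrix.smul_apply, permAlgHom_of, smul_eq_mul]

end PermutationMatrices

section Words

variable (n : ℕ) (ι : Type*)

/-- The action of the symmetric group on words by permuting the positions. -/
def wordAct : Equiv.Perm (Fin n) →* Equiv.Perm (Fin n → ι) where
  toFun σ := Equiv.arrowCongr σ (Equiv.refl ι)
  map_one' := by ext; rfl
  map_mul' σ τ := by ext; rfl

variable {n ι}

theorem wordAct_apply (σ : Equiv.Perm (Fin n)) (x : Fin n → ι) (k : Fin n) :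
    wordAct n ι σ x k = x (σ⁻¹ k) := rfl

theorem eq_wordAct_self_iff (σ : Equiv.Perm (Fin n)) (x : Fin n → ι) :
    x = wordAct n ι σ x ↔ ∀ k, x (σ k) = x k := by
  constructor
  · intro h k
    have := congrFun h (σ k)
    simpa [wordAct_apply] using this
  · intro h
    funext k
    rw [wordAct_apply, ← h (σ⁻¹ k)]
    simp

variable (n ι) (κ : Type*)

/-- The action of `Sₙ × Sₙ` on words in pairs. -/
def pairAct : Equiv.Perm (Fin n) × Equiv.Perm (Fin n) →* Equiv.Perm (Fin n → ι × κ) where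
  toFun p :=
    { toFun := fun z k => ((z (p.1⁻¹ k)).1, (z (p.2⁻¹ k)).2)
      invFun := fun z k => ((z (p.1 k)).1, (z (p.2 k)).2)
      left_inv := fun z => by simp
      right_inv := fun z => by simp }
  map_one' := by ext <;> rfl
  map_mul' σ τ := by ext <;> rfl

variable {n ι κ}

theorem eq_pairAct_iff (p : Equiv.Perm (Fin n) × Equiv.Perm (Fin n)) (z w : Fin n → ι × κ) :
    z = pairAct n ι κ p w ↔ (fun k => (z k).1) = wordAct n ι p.1 (fun k => (w k).1) ∧
      (fun k => (z k).2) = wordAct n κ p.2 (fun k => (w k).2) := by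
  simp only [funext_iff, Prod.ext_iff, ← forall_and]
  rfl

end Words

section YoungWords

variable (K : Type*) [Field K] {n : ℕ} {ι κ : Type*} [Fintype ι] [DecidableEq ι]
  [Fintype κ] [DecidableEq κ]

theorem permAlgHom_boxElt (x y : MonoidAlgebra K (Equiv.Perm (Fin n))) (z w : Fin n → ι × κ) :
    permAlgHom K (pairAct n ι κ) (boxElt x y) z w =
      permAlgHom K (wordAct n ι) x (fun k => (z k).1) (fun k => (w k).1) *
      permAlgHom K (wordAct n κ) y (fun k => (z k).2) (fun k => (w k).2) := by
  rw [permAlgHom_apply (wordAct n ι), permAlgHom_apply (wordAct n κ), Finset.sum_mul_sum, boxElt]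
  simp only [map_sum, map_smul, Matrix.sum_apply, Matrix.smul_apply, permAlgHom_of, smul_eq_mul,
    eq_pairAct_iff]
  refine Finset.sum_congr rfl fun g _ => Finset.sum_congr rfl fun h _ => ?_
  split_ifs <;> simp_all

theorem permAlgHom_boxElt_ne_zero_iff (x y : MonoidAlgebra K (Equiv.Perm (Fin n))) :
    permAlgHom K (pairAct n ι κ) (boxElt x y) ≠ 0 ↔
      permAlgHom K (wordAct n ι) x ≠ 0 ∧ permAlgHom K (wordAct n κ) y ≠ 0 := by
  constructor
  · intro h
    refine ⟨fun h0 => h ?_, fun h0 => h ?_⟩ <;>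
    · ext z w
      rw [permAlgHom_boxElt, h0]
      simp
  · rintro ⟨h1, h2⟩ h
    apply h1
    ext a b
    by_contra hab
    apply h2
    ext c d
    have := congrFun (congrFun h fun k => (a k, c k)) fun k => (b k, d k)
    rw [permAlgHom_boxElt] at this
    exact (mul_eq_zero.1 this).resolve_left hab

end YoungWords

section YoungWords

variable (K : Type) [Field K] [CharZero K] {n : ℕ} {ι : Type*} [Fintype ι] [DecidableEq ι]

theorem permAlgHom_colSum_eq_zero (lam : Nat.Partition n) (h : Fintype.card ι < lam.parts.card) :
    permAlgHom K (wordAct n ι) (colSum K (colFn lam)) = 0 := by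
  ext z w
  choose t ht using exists_colFn_eq_zero lam
  obtain ⟨i, j, hij, hw⟩ := Fintype.exists_ne_map_eq_of_card_lt (fun k => w (t k)) (by simpa)
  have hne : t i ≠ t j := fun h => hij (Fin.ext (by rw [← (ht i).1, ← (ht j).1, h]))
  have h1 := colSum_mul_of K (swap_mem_stabSubgroup
    (show colFn lam (t i) = colFn lam (t j) by rw [(ht i).2, (ht j).2]))
  have h2 : wordAct n ι (Equiv.swap (t i) (t j)) w = w := by
    refine ((eq_wordAct_self_iff _ _).2 fun k => ?_).symm
    rw [Equiv.swap_apply_def]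
    split_ifs with h1 h2
    · rw [h1]; exact hw.symm
    · rw [h2]; exact hw
    · rfl
  have h3 := mul_permAlgHom_of (wordAct n ι) (permAlgHom K (wordAct n ι) (colSum K (colFn lam)))
    (Equiv.swap (t i) (t j)) z w
  rw [← map_mul, h1, h2, Equiv.Perm.sign_swap hne] at h3
  simp only [map_smul, Matrix.smul_apply, Units.val_neg, Units.val_one, Int.cast_neg, Int.cast_one,
    smul_eq_mul, neg_mul, one_mul] at h3
  rw [neg_eq_iff_add_eq_zero, ← two_mul] at h3
  exact (mul_eq_zero.1 h3).resolve_left two_ne_zero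

theorem permAlgHom_young_ne_zero_iff (lam : Nat.Partition n) :
    permAlgHom K (wordAct n ι) (young K lam) ≠ 0 ↔ lam.parts.card ≤ Fintype.card ι := by
  constructor
  · intro h
    by_contra! hlt
    exact h (by rw [young, map_mul, permAlgHom_colSum_eq_zero K lam hlt, mul_zero])
  · intro hle h0
    obtain ⟨f⟩ : Nonempty (Fin lam.parts.card ↪ ι) :=
      Function.Embedding.nonempty_of_card_le (by simpa)
    let x : Fin n → ι := fun t => f ⟨rowFn lam t, rowFn_lt lam t⟩
    have hx : ∀ σ : Equiv.Perm (Fin n), x = wordAct n ι σ x ↔ σ ∈ stabSubgroup n (rowFn lam) := by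
      intro σ
      rw [eq_wordAct_self_iff]
      simp [x, mem_stabSubgroup]
    have h1 := congrFun (congrFun h0 x) x
    have hof : ∀ (g : Equiv.Perm (Fin n)) (a : K), permAlgHom K (wordAct n ι)
        (MonoidAlgebra.single g a) x x = if g ∈ stabSubgroup n (rowFn lam) then a else 0 := by
      intro g a
      have : MonoidAlgebra.single g a = a • MonoidAlgebra.of K _ g := by simp
      rw [this, map_smul, Matrix.smul_apply, permAlgHom_of, if_congr (hx g) rfl rfl]
      simp
    rw [young, rowSum, colSum, Finset.sum_mul_sum] at h1
    simp only [MonoidAlgebra.single_mul_single, map_sum, Matrix.sum_apply, hof, one_mul] at h1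
    have h2 : ∀ p : stabSubgroup n (rowFn lam), (∑ q : stabSubgroup n (colFn lam),
        if (p : Equiv.Perm (Fin n)) * q ∈ stabSubgroup n (rowFn lam) then
          ((Equiv.Perm.sign (q : Equiv.Perm (Fin n)) : ℤ) : K) else 0) = 1 := by
      intro p
      rw [Finset.sum_eq_single 1]
      · simp
      · intro q _ hq
        rw [if_neg]
        intro hpq
        rw [Subgroup.mul_mem_cancel_left _ p.2] at hpq
        apply hq
        ext t : 3
        have := (isTableau lam).injective (a₁ := (q : Equiv.Perm (Fin n)) t) (a₂ := t)
          (Prod.ext (hpq t) (q.2 t))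
        simp [this]
      · simp
    rw [Finset.sum_congr rfl fun p _ => h2 p] at h1
    simp at h1

end YoungWords

end KroneckerInvariants

namespace KroneckerInvariants

section WordPolynomials

theorem exists_perm_comp_eq {n : ℕ} {A : Type*} {x y : Fin n → A}
    (h : ∑ k, Finsupp.single (x k) 1 = ∑ k, (Finsupp.single (y k) 1 : A →₀ ℕ)) :
    ∃ σ : Equiv.Perm (Fin n), ∀ k, y (σ k) = x k := by
  classical
  have hcard : ∀ a, Nonempty ({k // x k = a} ≃ {k // y k = a}) := by
    intro a
    refine ⟨Fintype.equivOfCardEq ?_⟩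
    have := DFunLike.congr_fun h a
    simp only [Finsupp.finsetSum_apply, Finsupp.single_apply, Finset.sum_boole, Nat.cast_id] at this
    rwa [Fintype.card_subtype, Fintype.card_subtype]
  have e := fun a => (hcard a).some
  refine ⟨(Equiv.sigmaFiberEquiv x).symm.trans
    ((Equiv.sigmaCongrRight e).trans (Equiv.sigmaFiberEquiv y)), fun k => ?_⟩
  exact (e (x k) ⟨k, rfl⟩).2

variable {K A B : Type*} [Field K] [CharZero K] [Fintype A] [Fintype B] {n : ℕ}

theorem eq_zero_of_sum_prod_eq_zero (S : (Fin n → A) → K)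
    (hS : ∀ (σ : Equiv.Perm (Fin n)) x, S (fun k => x (σ k)) = S x) {p : MvPolynomial A K}
    (hp : p ≠ 0) (h : ∀ u : A → K, MvPolynomial.eval u p ≠ 0 → ∑ x, S x * ∏ k, u (x k) = 0)
    (x : Fin n → A) : S x = 0 := by
  classical
  set q : MvPolynomial A K := ∑ x, MvPolynomial.monomial (∑ k, Finsupp.single (x k) 1) (S x) with hq
  have heval : ∀ u : A → K, MvPolynomial.eval u q = ∑ x, S x * ∏ k, u (x k) := by
    intro u
    rw [hq, map_sum]
    refine Finset.sum_congr rfl fun x _ => ?_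
    rw [MvPolynomial.monomial_sum_index, map_mul, MvPolynomial.eval_C, map_prod]
    simp [MvPolynomial.eval_monomial]
  have hpq : p * q = 0 := by
    refine MvPolynomial.funext fun u => ?_
    rw [map_mul, map_zero, heval]
    by_cases hu : MvPolynomial.eval u p = 0
    · rw [hu, zero_mul]
    · rw [h u hu, mul_zero]
  have hq0 := (mul_eq_zero.1 hpq).resolve_left hp
  have hc := congrArg (MvPolynomial.coeff (∑ k, Finsupp.single (x k) 1)) hq0
  rw [hq, MvPolynomial.coeff_sum, MvPolynomial.coeff_zero] at hc
  simp only [MvPolynomial.coeff_monomial] at hc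
  have hterm : ∀ y : Fin n → A,
      (if ∑ k, Finsupp.single (y k) 1 = ∑ k, (Finsupp.single (x k) 1 : A →₀ ℕ) then S y else 0) =
      (if ∑ k, Finsupp.single (y k) 1 = ∑ k, (Finsupp.single (x k) 1 : A →₀ ℕ) then 1 else 0) *
        S x := by
    intro y
    split_ifs with hy
    · obtain ⟨σ, hσ⟩ := exists_perm_comp_eq hy
      rw [one_mul, ← hS σ x]
      exact congrArg S (funext fun k => (hσ k).symm)
    · rw [zero_mul]
  rw [Finset.sum_congr rfl fun y _ => hterm y, ← Finset.sum_mul, Finset.sum_boole] at hc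
  refine (mul_eq_zero.1 hc).resolve_left ?_
  rw [Nat.cast_eq_zero, Finset.card_eq_zero]
  exact Finset.Nonempty.ne_empty ⟨x, by simp⟩

theorem sum_mul_eq_zero_of_forall_prod (φ : (Fin n → A) → (Fin n → B) → K)
    {p : MvPolynomial A K} (hp : p ≠ 0) {q : MvPolynomial B K} (hq : q ≠ 0)
    (h : ∀ (g : A → K) (l : B → K), MvPolynomial.eval g p ≠ 0 → MvPolynomial.eval l q ≠ 0 →
      ∑ a, ∑ b, φ a b * ((∏ k, g (a k)) * ∏ k, l (b k)) = 0)
    (N : (Fin n → A) → (Fin n → B) → K)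
    (hN : ∀ (σ τ : Equiv.Perm (Fin n)) a b, N (fun k => a (σ k)) (fun k => b (τ k)) = N a b) :
    ∑ a, ∑ b, φ a b * N a b = 0 := by
  have havg : ∀ N : (Fin n → A) → (Fin n → B) → K,
      (∀ (σ τ : Equiv.Perm (Fin n)) a b, N (fun k => a (σ k)) (fun k => b (τ k)) = N a b) →
      ∑ a, ∑ b, (∑ σ : Equiv.Perm (Fin n), ∑ τ : Equiv.Perm (Fin n),
        φ (fun k => a (σ k)) (fun k => b (τ k))) * N a b =
      (Fintype.card (Equiv.Perm (Fin n)) : K) ^ 2 * ∑ a, ∑ b, φ a b * N a b := by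
    intro N hN
    have h1 : ∀ σ τ : Equiv.Perm (Fin n),
        ∑ a, ∑ b, φ (fun k => a (σ k)) (fun k => b (τ k)) * N a b = ∑ a, ∑ b, φ a b * N a b := by
      intro σ τ
      refine Fintype.sum_equiv (Equiv.arrowCongr σ.symm (Equiv.refl A)) _ _ fun a => ?_
      refine Fintype.sum_equiv (Equiv.arrowCongr τ.symm (Equiv.refl B)) _ _ fun b => ?_
      rw [← hN σ τ a b]
      rfl
    calc _ = ∑ σ : Equiv.Perm (Fin n), ∑ τ : Equiv.Perm (Fin n), ∑ a, ∑ b,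
          φ (fun k => a (σ k)) (fun k => b (τ k)) * N a b := by
          simp only [Finset.sum_mul]
          rw [Finset.sum_congr rfl fun a _ => Finset.sum_comm, Finset.sum_comm]
          refine Finset.sum_congr rfl fun σ _ => ?_
          rw [Finset.sum_congr rfl fun a _ => Finset.sum_comm, Finset.sum_comm]
      _ = _ := by
        simp only [h1, Finset.sum_const, Finset.card_univ, nsmul_eq_mul]
        ring
  set ψ : (Fin n → A) → (Fin n → B) → K := fun a b => ∑ σ : Equiv.Perm (Fin n),
    ∑ τ : Equiv.Perm (Fin n), φ (fun k => a (σ k)) (fun k => b (τ k)) with hψ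
  have hψA : ∀ (σ : Equiv.Perm (Fin n)) a b, ψ (fun k => a (σ k)) b = ψ a b := by
    intro σ a b
    exact Fintype.sum_equiv (Equiv.mulLeft σ) _ _ fun σ' => rfl
  have hψB : ∀ (τ : Equiv.Perm (Fin n)) a b, ψ a (fun k => b (τ k)) = ψ a b := by
    intro τ a b
    refine Finset.sum_congr rfl fun σ _ => ?_
    exact Fintype.sum_equiv (Equiv.mulLeft τ) _ _ fun τ' => rfl
  have hψ0 : ∀ a b, ψ a b = 0 := by
    intro a
    refine eq_zero_of_sum_prod_eq_zero _ (fun τ b => hψB τ a b) hq fun l hl => ?_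
    refine eq_zero_of_sum_prod_eq_zero (fun a => ∑ b, ψ a b * ∏ k, l (b k)) (fun σ a => ?_) hp
      (fun g hg => ?_) a
    · simp only [hψA]
    · have := havg (fun a b => (∏ k, g (a k)) * ∏ k, l (b k)) fun σ τ a b => by
        rw [Equiv.prod_comp σ fun k => g (a k), Equiv.prod_comp τ fun k => l (b k)]
      rw [h g l hg hl, mul_zero] at this
      rw [← this]
      refine Finset.sum_congr rfl fun a _ => ?_
      rw [Finset.sum_mul]
      refine Finset.sum_congr rfl fun b _ => ?_
      ring
  have hsum : ∑ a, ∑ b, ψ a b * N a b = 0 := by simp [hψ0]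
  exact (mul_eq_zero.1 ((havg N hN).symm.trans hsum)).resolve_left (by simp [Fintype.card_ne_zero])

end WordPolynomials

end KroneckerInvariants

namespace KroneckerInvariants

section TensorPowers

open scoped Kronecker

variable {K : Type*} [Field K] {J : Type*} (n : ℕ)

/-- The `n`-th Kronecker power of a matrix. -/
def kronPow (u : Matrix J J K) : Matrix (Fin n → J) (Fin n → J) K :=
  Matrix.of fun x y => ∏ k, u (x k) (y k)

theorem kronPow_apply (u : Matrix J J K) (x y : Fin n → J) :
    kronPow n u x y = ∏ k, u (x k) (y k) := rfl

theorem kronPow_one [DecidableEq J] : kronPow n (1 : Matrix J J K) = 1 := by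
  ext x y
  by_cases h : x = y
  · subst h
    simp [kronPow_apply, Matrix.one_apply_eq]
  · rw [Matrix.one_apply_ne h, kronPow_apply]
    obtain ⟨k, hk⟩ := Function.ne_iff.1 h
    exact Finset.prod_eq_zero (Finset.mem_univ k) (Matrix.one_apply_ne hk)

variable [Fintype J]

theorem kronPow_mul (u v : Matrix J J K) : kronPow n (u * v) = kronPow n u * kronPow n v := by
  ext x y
  simp only [kronPow_apply, Matrix.mul_apply, Finset.prod_univ_sum, Fintype.piFinset_univ,
    Finset.prod_mul_distrib]

variable [DecidableEq J]

/-- The polynomial function `u ↦ tr (T u^{⊗ n})`. -/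
def traceForm : Matrix (Fin n → J) (Fin n → J) K →ₗ[K] (Matrix J J K → K) where
  toFun T u := (T * kronPow n u).trace
  map_add' S T := by
    ext u
    simp [add_mul]
  map_smul' c T := by
    ext u
    simp

theorem traceForm_apply (T : Matrix (Fin n → J) (Fin n → J) K) (u : Matrix J J K) :
    traceForm n T u = (T * kronPow n u).trace := rfl

theorem traceForm_eq_sum (T : Matrix (Fin n → J) (Fin n → J) K) (u : Matrix J J K) :
    traceForm n T u = ∑ x, ∑ y, T x y * ∏ k, u (y k) (x k) := by
  simp only [traceForm_apply, Matrix.trace, Matrix.diag_apply, Matrix.mul_apply, kronPow_apply]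

theorem traceForm_conj (T : Matrix (Fin n → J) (Fin n → J) K) (g u l : Matrix J J K) :
    traceForm n T (g * u * l) = traceForm n (kronPow n l * T * kronPow n g) u := by
  rw [traceForm_apply, traceForm_apply, kronPow_mul, kronPow_mul, ← mul_assoc,
    Matrix.trace_mul_comm]
  simp only [mul_assoc]

/-- The equivalence between words in pairs and pairs of words. -/
def wordPairEquiv (A B : Type*) : (Fin n → A × B) ≃ (Fin n → A) × (Fin n → B) :=
  Equiv.arrowProdEquivProdArrow (Fin n) (fun _ => A) (fun _ => B)

variable {n}

theorem eq_zero_of_traceForm_eq_zero [CharZero K] (T : Matrix (Fin n → J) (Fin n → J) K)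
    (hT : ∀ (σ : Equiv.Perm (Fin n)) x y, T (wordAct n J σ x) (wordAct n J σ y) = T x y)
    (h : traceForm n T = 0) : T = 0 := by
  ext x y
  refine eq_zero_of_sum_prod_eq_zero (A := J × J) (p := 1)
    (fun a => T (fun k => (a k).1) fun k => (a k).2) (fun σ a => ?_) one_ne_zero (fun u _ => ?_)
    fun k => (x k, y k)
  · exact hT σ⁻¹ (fun k => (a k).1) (fun k => (a k).2)
  · have := congrFun h (Matrix.of fun i j => u (j, i))
    rw [traceForm_eq_sum, ← Fintype.sum_prod_type'] at this
    refine (Fintype.sum_equiv (wordPairEquiv n J J) _ _ fun a => ?_).trans this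
    rfl

theorem exists_traceForm_eq [CharZero K] (m : MultilinearMap K (fun _ : Fin n => Matrix J J K) K) :
    ∃ T : Matrix (Fin n → J) (Fin n → J) K,
      (∀ (σ : Equiv.Perm (Fin n)) x y, T (wordAct n J σ x) (wordAct n J σ y) = T x y) ∧
        ∀ u, traceForm n T u = m fun _ => u := by
  set M : Matrix (Fin n → J) (Fin n → J) K :=
    Matrix.of fun x y => m fun k => Matrix.single (y k) (x k) 1
  have hexp : ∀ u, traceForm n M u = m fun _ => u := by
    intro u
    have hu : (fun _ : Fin n => u) =
        fun _ => ∑ p : J × J, u p.2 p.1 • Matrix.single p.2 p.1 (1 : K) := by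
      funext _
      rw [Fintype.sum_prod_type_right]
      simpa using Matrix.matrix_eq_sum_single u
    rw [hu, MultilinearMap.map_sum, traceForm_eq_sum, ← Fintype.sum_prod_type']
    refine (Fintype.sum_equiv (wordPairEquiv n J J) _ _ fun a => ?_).symm
    rw [MultilinearMap.map_smul_univ, smul_eq_mul, mul_comm]
    rfl
  refine ⟨(Fintype.card (Equiv.Perm (Fin n)) : K)⁻¹ • ∑ σ : Equiv.Perm (Fin n),
    M.submatrix (wordAct n J σ) (wordAct n J σ), fun τ x y => ?_, fun u => ?_⟩
  · simp only [Matrix.smul_apply, Matrix.sum_apply]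
    congr 1
    refine Fintype.sum_equiv (Equiv.mulRight τ) _ _ fun σ => ?_
    simp [map_mul]
  · have hσ : ∀ σ : Equiv.Perm (Fin n), traceForm n
        (M.submatrix (wordAct n J σ) (wordAct n J σ)) u = traceForm n M u := by
      intro σ
      rw [traceForm_eq_sum, traceForm_eq_sum]
      refine Fintype.sum_equiv (wordAct n J σ) _ _ fun x => ?_
      refine Fintype.sum_equiv (wordAct n J σ) _ _ fun y => ?_
      congr 1
      exact (Equiv.prod_comp σ⁻¹ fun k => u (y k) (x k)).symm
    rw [map_smul, map_sum, Pi.smul_apply, Finset.sum_apply, Finset.sum_congr rfl fun σ _ => hσ σ]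
    rw [hexp, Finset.sum_const, Finset.card_univ, nsmul_eq_mul, smul_eq_mul, ← mul_assoc,
      inv_mul_cancel₀ (by simp [Fintype.card_ne_zero]), one_mul]

end TensorPowers

section Commutants

open scoped Kronecker

variable {K : Type*} [Field K] {n : ℕ} {ι κ : Type*} [Fintype ι] [DecidableEq ι]
  [Fintype κ] [DecidableEq κ]

theorem kronPow_kronecker_pairAct {ι κ : Type*} (g : Matrix ι ι K) (l : Matrix κ κ K)
    (p : Equiv.Perm (Fin n) × Equiv.Perm (Fin n)) (z w : Fin n → ι × κ) :
    kronPow n (g ⊗ₖ l) (pairAct n ι κ p z) (pairAct n ι κ p w) = kronPow n (g ⊗ₖ l) z w := by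
  simp only [kronPow_apply, Matrix.kroneckerMap_apply, Finset.prod_mul_distrib]
  congr 1
  · exact Equiv.prod_comp p.1⁻¹ fun k => g (z k).1 (w k).1
  · exact Equiv.prod_comp p.2⁻¹ fun k => l (z k).2 (w k).2

theorem kronPow_kronecker_comm (g : Matrix ι ι K) (l : Matrix κ κ K)
    (x : MonoidAlgebra K (Equiv.Perm (Fin n) × Equiv.Perm (Fin n))) :
    kronPow n (g ⊗ₖ l) * permAlgHom K (pairAct n ι κ) x =
      permAlgHom K (pairAct n ι κ) x * kronPow n (g ⊗ₖ l) := by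
  rw [groupAlgebra_eq_sum x]
  simp only [map_sum, map_smul, Finset.mul_sum, Finset.sum_mul, mul_smul_comm, smul_mul_assoc]
  refine Finset.sum_congr rfl fun p _ => ?_
  rw [(commute_permAlgHom_iff (pairAct n ι κ) _ p).2 (kronPow_kronecker_pairAct g l p)]

/-- Regrouping a pair of words in `ι × κ` into a word in `ι × ι` and a word in `κ × κ`. -/
def regroupEquiv (n : ℕ) (ι κ : Type*) :
    (Fin n → ι × ι) × (Fin n → κ × κ) ≃ (Fin n → ι × κ) × (Fin n → ι × κ) where
  toFun c := (fun k => ((c.1 k).1, (c.2 k).1), fun k => ((c.1 k).2, (c.2 k).2))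
  invFun c := (fun k => ((c.1 k).1, (c.2 k).1), fun k => ((c.1 k).2, (c.2 k).2))
  left_inv _ := rfl
  right_inv _ := rfl

theorem sum_mul_eq_zero_of_forall_kronPow [CharZero K] (c : (Fin n → ι × κ) → (Fin n → ι × κ) → K)
    (hc : ∀ (g : Matrix ι ι K) (l : Matrix κ κ K), g.det ≠ 0 → l.det ≠ 0 →
      ∑ x, ∑ y, c x y * kronPow n (g ⊗ₖ l) x y = 0)
    (N : Matrix (Fin n → ι × κ) (Fin n → ι × κ) K)
    (hN : ∀ p z w, N (pairAct n ι κ p z) (pairAct n ι κ p w) = N z w) :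
    ∑ x, ∑ y, c x y * N x y = 0 := by
  have hre : ∀ M : Matrix (Fin n → ι × κ) (Fin n → ι × κ) K,
      ∑ x, ∑ y, c x y * M x y = ∑ a : Fin n → ι × ι, ∑ b : Fin n → κ × κ,
        c (regroupEquiv n ι κ (a, b)).1 (regroupEquiv n ι κ (a, b)).2 *
          M (regroupEquiv n ι κ (a, b)).1 (regroupEquiv n ι κ (a, b)).2 := by
    intro M
    rw [← Fintype.sum_prod_type', ← Fintype.sum_prod_type']
    exact (Equiv.sum_comp (regroupEquiv n ι κ) fun q => c q.1 q.2 * M q.1 q.2).symm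
  rw [hre]
  refine sum_mul_eq_zero_of_forall_prod
    (fun a b => c (regroupEquiv n ι κ (a, b)).1 (regroupEquiv n ι κ (a, b)).2)
    (Matrix.det_mvPolynomialX_ne_zero ι K) (Matrix.det_mvPolynomialX_ne_zero κ K)
    (fun g l hg hl => ?_)
    (fun a b => N (regroupEquiv n ι κ (a, b)).1 (regroupEquiv n ι κ (a, b)).2) fun σ τ a b => ?_
  · rw [Matrix.eval_det_mvPolynomialX] at hg hl
    have := hc _ _ hg hl
    rw [hre] at this
    simp only [kronPow_apply, Matrix.kroneckerMap_apply, Finset.prod_mul_distrib] at this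
    exact this
  · exact hN (σ⁻¹, τ⁻¹) (regroupEquiv n ι κ (a, b)).1 (regroupEquiv n ι κ (a, b)).2

theorem mem_range_permAlgHom_of_commute [CharZero K]
    (T : Matrix (Fin n → ι × κ) (Fin n → ι × κ) K)
    (hT : ∀ (g : Matrix ι ι K) (l : Matrix κ κ K), g.det ≠ 0 → l.det ≠ 0 →
      T * kronPow n (g ⊗ₖ l) = kronPow n (g ⊗ₖ l) * T) :
    T ∈ (permAlgHom K (pairAct n ι κ)).range := by
  refine mem_range_of_forall_commute _ T fun N hN => ?_
  ext z w
  have key : ∀ M : Matrix (Fin n → ι × κ) (Fin n → ι × κ) K, (T * M) z w - (M * T) z w =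
      ∑ x, ∑ y, ((if y = w then T z x else 0) - if x = z then T y w else 0) * M x y := by
    intro M
    simp only [sub_mul, Finset.sum_sub_distrib, ite_mul, zero_mul, Matrix.mul_apply]
    congr 1
    · simp
    · rw [Finset.sum_comm]
      simp [mul_comm]
  rw [← sub_eq_zero, key]
  refine sum_mul_eq_zero_of_forall_kronPow _ (fun g l hg hl => ?_) N
    fun p => (commute_permAlgHom_iff (pairAct n ι κ) N p).1 (hN p)
  rw [← key, hT g l hg hl, sub_self]

theorem forall_commute_diag_iff (T : Matrix (Fin n → ι × κ) (Fin n → ι × κ) K) :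
    (∀ s, T * permAlgHom K (pairAct n ι κ) (MonoidAlgebra.of K _ (s, s)) =
      permAlgHom K (pairAct n ι κ) (MonoidAlgebra.of K _ (s, s)) * T) ↔
    ∀ (σ : Equiv.Perm (Fin n)) x y,
      T (wordAct n (ι × κ) σ x) (wordAct n (ι × κ) σ y) = T x y :=
  forall_congr' fun σ => commute_permAlgHom_iff (pairAct n ι κ) T (σ, σ)

variable (K n ι κ) in
/-- The matrices in the image of the group algebra of `Sₙ × Sₙ` that commute with the diagonal
copy of `Sₙ`. -/
noncomputable def diagCommutant : Submodule K (Matrix (Fin n → ι × κ) (Fin n → ι × κ) K) where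
  carrier := {T | T ∈ (permAlgHom K (pairAct n ι κ)).range ∧
    ∀ s, T * permAlgHom K (pairAct n ι κ) (MonoidAlgebra.of K _ (s, s)) =
      permAlgHom K (pairAct n ι κ) (MonoidAlgebra.of K _ (s, s)) * T}
  add_mem' hS hT := ⟨add_mem hS.1 hT.1, fun s => by rw [add_mul, mul_add, hS.2, hT.2]⟩
  zero_mem' := ⟨zero_mem _, fun s => by rw [zero_mul, mul_zero]⟩
  smul_mem' c T hT := ⟨Subalgebra.smul_mem _ hT.1 c, fun s => by
    rw [smul_mul_assoc, mul_smul_comm, hT.2]⟩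

theorem mem_diagCommutant {T : Matrix (Fin n → ι × κ) (Fin n → ι × κ) K} :
    T ∈ diagCommutant K n ι κ ↔ T ∈ (permAlgHom K (pairAct n ι κ)).range ∧
      ∀ s, T * permAlgHom K (pairAct n ι κ) (MonoidAlgebra.of K _ (s, s)) =
        permAlgHom K (pairAct n ι κ) (MonoidAlgebra.of K _ (s, s)) * T := Iff.rfl

theorem kronecker_mul_kronecker_eq_one {g g' : Matrix ι ι K} {l l' : Matrix κ κ K}
    (hg : g * g' = 1) (hl : l * l' = 1) : (g ⊗ₖ l) * (g' ⊗ₖ l') = 1 := by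
  rw [← Matrix.mul_kronecker_mul, hg, hl, Matrix.one_kronecker_one]

theorem traceForm_conj_of_mem_diagCommutant {T : Matrix (Fin n → ι × κ) (Fin n → ι × κ) K}
    (hT : T ∈ diagCommutant K n ι κ) {g g' : Matrix ι ι K} {l l' : Matrix κ κ K}
    (hg : g * g' = 1) (hl : l * l' = 1) (u : Matrix (ι × κ) (ι × κ) K) :
    traceForm n T ((g ⊗ₖ l) * u * (g' ⊗ₖ l')) = traceForm n T u := by
  obtain ⟨x, rfl⟩ := hT.1
  rw [traceForm_conj]
  change traceForm n (_ * permAlgHom K (pairAct n ι κ) x * _) u = _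
  rw [mul_assoc, ← kronPow_kronecker_comm, ← mul_assoc, ← kronPow_mul,
    kronecker_mul_kronecker_eq_one (mul_eq_one_comm.1 hg) (mul_eq_one_comm.1 hl), kronPow_one,
    one_mul]
  rfl

theorem exists_mem_diagCommutant_traceForm_eq [CharZero K]
    (m : MultilinearMap K (fun _ : Fin n => Matrix (ι × κ) (ι × κ) K) K)
    (hm : ∀ (g g' : Matrix ι ι K) (l l' : Matrix κ κ K), g * g' = 1 → l * l' = 1 → ∀ u,
      (m fun _ => (g ⊗ₖ l) * u * (g' ⊗ₖ l')) = m fun _ => u) :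
    ∃ T ∈ diagCommutant K n ι κ, ∀ u, traceForm n T u = m fun _ => u := by
  obtain ⟨T, hT, hTm⟩ := exists_traceForm_eq m
  refine ⟨T, ⟨mem_range_permAlgHom_of_commute T fun g l hg hl => ?_,
    (forall_commute_diag_iff T).2 hT⟩, hTm⟩
  have hg' : g * g⁻¹ = 1 := Matrix.mul_nonsing_inv g hg.isUnit
  have hl' : l * l⁻¹ = 1 := Matrix.mul_nonsing_inv l hl.isUnit
  have hcomm : kronPow n (g⁻¹ ⊗ₖ l⁻¹) * T * kronPow n (g ⊗ₖ l) - T = 0 := by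
    refine eq_zero_of_traceForm_eq_zero _ ((forall_commute_diag_iff _).1 fun s => ?_) ?_
    · have hTs := (forall_commute_diag_iff T).2 hT s
      rw [sub_mul, mul_sub, hTs, mul_assoc, kronPow_kronecker_comm, mul_assoc, ← mul_assoc T, hTs]
      simp only [← mul_assoc]
      rw [kronPow_kronecker_comm]
    · ext u
      rw [map_sub, Pi.sub_apply, ← traceForm_conj, hTm, hTm, hm g g⁻¹ l l⁻¹ hg' hl', sub_self]
      rfl
  have h1 : kronPow n (g ⊗ₖ l) * kronPow n (g⁻¹ ⊗ₖ l⁻¹) = 1 := by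
    rw [← kronPow_mul, kronecker_mul_kronecker_eq_one hg' hl', kronPow_one]
  calc T * kronPow n (g ⊗ₖ l) =
      (kronPow n (g ⊗ₖ l) * kronPow n (g⁻¹ ⊗ₖ l⁻¹)) * T * kronPow n (g ⊗ₖ l) := by
        rw [h1, one_mul]
    _ = kronPow n (g ⊗ₖ l) * (kronPow n (g⁻¹ ⊗ₖ l⁻¹) * T * kronPow n (g ⊗ₖ l)) := by
        simp only [mul_assoc]
    _ = _ := by rw [sub_eq_zero.1 hcomm]

end Commutants

end KroneckerInvariants

namespace KroneckerInvariants

section InvariantPolynomials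

open scoped Kronecker

variable {K V W : Type} [Field K] [AddCommGroup V] [Module K V] [AddCommGroup W] [Module K W]
  {ι κ : Type} [Fintype ι] [DecidableEq ι] [Fintype κ] [DecidableEq κ]
  (bV : Module.Basis ι K V) (bW : Module.Basis κ K W) (n : ℕ)

/-- Endomorphisms of `V ⊗ W` as matrices with respect to a pair of bases. -/
noncomputable def endMatrix :
    (TensorProduct K V W →ₗ[K] TensorProduct K V W) ≃ₗ[K] Matrix (ι × κ) (ι × κ) K :=
  LinearMap.toMatrix (bV.tensorProduct bW) (bV.tensorProduct bW)

theorem endMatrix_tensorConjAction (γ : (V ≃ₗ[K] V) × (W ≃ₗ[K] W))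
    (u : TensorProduct K V W →ₗ[K] TensorProduct K V W) :
    endMatrix bV bW (tensorConjAction K V W γ u) =
      (LinearMap.toMatrix bV bV γ.1.toLinearMap ⊗ₖ LinearMap.toMatrix bW bW γ.2.toLinearMap) *
        endMatrix bV bW u *
        (LinearMap.toMatrix bV bV γ.1.symm.toLinearMap ⊗ₖ
          LinearMap.toMatrix bW bW γ.2.symm.toLinearMap) := by
  rw [← TensorProduct.toMatrix_map, ← TensorProduct.toMatrix_map]
  simp only [endMatrix]
  rw [← LinearMap.toMatrix_comp, ← LinearMap.toMatrix_comp]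
  rfl

theorem toMatrix_mul_toMatrix_symm (e : V ≃ₗ[K] V) :
    LinearMap.toMatrix bV bV e.toLinearMap * LinearMap.toMatrix bV bV e.symm.toLinearMap = 1 := by
  rw [← LinearMap.toMatrix_comp]
  simp

theorem exists_toMatrix_eq {g g' : Matrix ι ι K} (h : g * g' = 1) :
    ∃ e : V ≃ₗ[K] V, LinearMap.toMatrix bV bV e.toLinearMap = g ∧
      LinearMap.toMatrix bV bV e.symm.toLinearMap = g' := by
  refine ⟨LinearEquiv.ofLinearMap (Matrix.toLin bV bV g) (Matrix.toLin bV bV g') ?_ ?_, ?_, ?_⟩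
  · rw [← Matrix.toLin_mul, h, Matrix.toLin_one]
  · rw [← Matrix.toLin_mul, mul_eq_one_comm.1 h, Matrix.toLin_one]
  · exact LinearMap.toMatrix_toLin bV bV g
  · exact LinearMap.toMatrix_toLin bV bV g'

/-- The polynomial function on `End (V ⊗ W)` attached to a matrix indexed by words. -/
noncomputable def endTraceForm : Matrix (Fin n → ι × κ) (Fin n → ι × κ) K →ₗ[K]
    ((TensorProduct K V W →ₗ[K] TensorProduct K V W) → K) :=
  LinearMap.funLeft K K (endMatrix bV bW) ∘ₗ traceForm n

theorem endTraceForm_apply (T : Matrix (Fin n → ι × κ) (Fin n → ι × κ) K)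
    (u : TensorProduct K V W →ₗ[K] TensorProduct K V W) :
    endTraceForm bV bW n T u = traceForm n T (endMatrix bV bW u) := rfl

theorem exists_multilinearMap_traceForm_eq {J : Type*} [Fintype J] [DecidableEq J]
    (T : Matrix (Fin n → J) (Fin n → J) K) :
    ∃ m : MultilinearMap K (fun _ : Fin n => Matrix J J K) K,
      ∀ u, traceForm n T u = m fun _ => u := by
  refine ⟨∑ x, ∑ y, T x y • (MultilinearMap.mkPiAlgebra K (Fin n) K).compLinearMap
    fun k => Matrix.entryLinearMap K K (y k) (x k), fun u => ?_⟩
  simp [traceForm_eq_sum]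

theorem map_diagCommutant_eq [CharZero K] : (diagCommutant K n ι κ).map (endTraceForm bV bW n) =
    invariantPolynomials K (tensorConjAction K V W) n := by
  ext F
  constructor
  · rintro ⟨T, hT, rfl⟩
    refine ⟨?_, fun γ u => ?_⟩
    · obtain ⟨m, hm⟩ := exists_multilinearMap_traceForm_eq n T
      exact ⟨m.compLinearMap fun _ => (endMatrix bV bW).toLinearMap, fun u => hm _⟩
    · rw [endTraceForm_apply, endTraceForm_apply, endMatrix_tensorConjAction]
      exact traceForm_conj_of_mem_diagCommutant hT (toMatrix_mul_toMatrix_symm bV γ.1)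
        (toMatrix_mul_toMatrix_symm bW γ.2) _
  · rintro ⟨⟨m, hm⟩, hF⟩
    obtain ⟨T, hT, hTm⟩ := exists_mem_diagCommutant_traceForm_eq
      (m.compLinearMap fun _ => (endMatrix bV bW).symm.toLinearMap) (fun g g' l l' hg hl u => by
        obtain ⟨e, rfl, rfl⟩ := exists_toMatrix_eq bV hg
        obtain ⟨f, rfl, rfl⟩ := exists_toMatrix_eq bW hl
        obtain ⟨v, rfl⟩ := (endMatrix bV bW).surjective u
        have := endMatrix_tensorConjAction bV bW (e, f) v
        rw [← this]
        simp only [MultilinearMap.compLinearMap_apply, LinearEquiv.coe_coe,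
          LinearEquiv.symm_apply_apply]
        rw [← hm, ← hm]
        exact hF (e, f) v)
    refine ⟨T, hT, ?_⟩
    ext u
    rw [endTraceForm_apply, hTm, hm]
    simp

theorem finrank_invariantPolynomials [CharZero K] (bV : Module.Basis ι K V)
    (bW : Module.Basis κ K W) :
    Module.finrank K (invariantPolynomials K (tensorConjAction K V W) n) =
      Module.finrank K (diagCommutant K n ι κ) := by
  rw [← map_diagCommutant_eq bV bW, ← LinearMap.range_domRestrict]
  refine LinearMap.finrank_range_of_inj ((injective_iff_map_eq_zero _).2 fun T hT => ?_)
  refine Subtype.ext (eq_zero_of_traceForm_eq_zero T.1 ((forall_commute_diag_iff T.1).1 T.2.2) ?_)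
  ext u
  have := congrFun hT ((endMatrix bV bW).symm u)
  rwa [LinearMap.domRestrict_apply, endTraceForm_apply, LinearEquiv.apply_symm_apply] at this

end InvariantPolynomials

end KroneckerInvariants

/-- For `dim V = d₁` and `dim W = d₂`, the dimension of the `n`-th homogeneous component of
the invariant ring `K[End(V ⊗ W)]^{GL(V) × GL(W)}` equals
`Σ_{λ,μ,ν ⊢ n, r(λ) ≤ d₁, r(μ) ≤ d₂} g(λ,μ,ν)²`,
where `g(λ,μ,ν)` are the Kronecker coefficients of `Sₙ`. -/
theorem stmt0 (K : Type) [Field K] [CharZero K] (V W : Type) [AddCommGroup V] [Module K V]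
    [AddCommGroup W] [Module K W] [FiniteDimensional K V] [FiniteDimensional K W]
    (d₁ d₂ : ℕ) (hV : Module.finrank K V = d₁) (hW : Module.finrank K W = d₂) (n : ℕ) :
    Module.finrank K (invariantPolynomials K (tensorConjAction K V W) n) =
      ∑ lam : Nat.Partition n, ∑ mu : Nat.Partition n, ∑ nu : Nat.Partition n,
        if lam.parts.card ≤ d₁ ∧ mu.parts.card ≤ d₂ then kron K lam mu nu ^ 2 else 0 := by
  rw [KroneckerInvariants.finrank_invariantPolynomials n
    (Module.finBasisOfFinrankEq K V hV) (Module.finBasisOfFinrankEq K W hW)]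
  refine KroneckerInvariants.finrank_range_commuting_diag K
    (KroneckerInvariants.permAlgHom K (KroneckerInvariants.pairAct n (Fin d₁) (Fin d₂))) d₁ d₂
    (fun lam mu => ?_) _ fun T => KroneckerInvariants.mem_diagCommutant
  rw [KroneckerInvariants.permAlgHom_boxElt_ne_zero_iff,
    KroneckerInvariants.permAlgHom_young_ne_zero_iff,
    KroneckerInvariants.permAlgHom_young_ne_zero_iff, Fintype.card_fin, Fintype.card_fin]
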